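/- arXiv:2111.10279 — 5 statements merged into one kernel-verified Lean document; each statement's English description precedes it below -/
import Mathlib

section
/- For all integers n ≥ 0 and 0 ≤ i ≤ n, one has the identity of formal power series in q: ∑_{m≥0} C_{i,n}(m) q^m = (q^{i+1}, q^{n−i+1}, q^{n+2}; q^{n+2})_∞ / ((q; q²)_∞ (q; q)_∞). -/
open scoped BigOperators

/-- The infinite q-Pochhammer symbol `(a; q)_∞ = ∏_{k≥0} (1 - a qᵏ)`. -/
noncomputable def qPoch (a q : ℂ) : ℂ := ∏' k : ℕ, (1 - a * q ^ k)

/-- The set of `(n+1)`-coloured partitions (lists of pairs (part, colour) with colours in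
`{0,…,n}`) such that consecutive parts satisfy `λ_j − λ_{j+1} = |u_j − u_{j+1}|`, the last part
is `0` with colour `i`, the penultimate part (if it exists) has colour different from `i`,
and the weight (sum of the parts) is `m`. -/
def CeqSet (n i m : ℕ) : Set (List (ℤ × ℕ)) :=
  {L | (∀ p ∈ L, p.2 ≤ n) ∧
       List.Chain' (fun x y => x.1 - y.1 = |(x.2 : ℤ) - (y.2 : ℤ)|) L ∧
       L.getLast? = some (0, i) ∧
       (∀ p ∈ L.reverse[1]?, p.2 ≠ i) ∧
       (L.map Prod.fst).sum = (m : ℤ)}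

/-- `C_{i,n}(m)`: the number of such coloured partitions of weight `m`. -/
noncomputable def Ceq (n i m : ℕ) : ℕ := (CeqSet n i m).ncard

/-! ### Coloured partitions as colour sequences -/

/-- The coloured partition, listed from its last part `(a, u)` upwards, whose colours are `u`
followed by the entries of the list, with minimal differences between consecutive parts. -/
def pathParts {n : ℕ} : ℤ → Fin (n + 1) → List (Fin (n + 1)) → List (ℤ × ℕ)
  | a, u, [] => [(a, (u : ℕ))]
  | a, u, w :: ws => (a, (u : ℕ)) :: pathParts (a + |((w : ℕ) : ℤ) - ((u : ℕ) : ℤ)|) w ws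

/-- The weight of `pathParts 0 u ws`. -/
def pathWeight {n : ℕ} : Fin (n + 1) → List (Fin (n + 1)) → ℕ
  | _, [] => 0
  | u, w :: ws =>
    (ws.length + 1) * (((w : ℕ) : ℤ) - ((u : ℕ) : ℤ)).natAbs + pathWeight w ws

lemma pathParts_eq_cons {n : ℕ} (a : ℤ) (u : Fin (n + 1)) (ws : List (Fin (n + 1))) :
    ∃ l, pathParts a u ws = (a, (u : ℕ)) :: l := by
  cases ws <;> simp [pathParts]

lemma pathParts_map_snd {n : ℕ} (ws : List (Fin (n + 1))) (a : ℤ) (u : Fin (n + 1)) :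
    (pathParts a u ws).map Prod.snd = (u : ℕ) :: ws.map Fin.val := by
  induction ws generalizing a u with
  | nil => simp [pathParts]
  | cons w ws ih => simp [pathParts, ih]

lemma pathParts_sum {n : ℕ} (ws : List (Fin (n + 1))) (a : ℤ) (u : Fin (n + 1)) :
    ((pathParts a u ws).map Prod.fst).sum = (ws.length + 1) * a + pathWeight u ws := by
  induction ws generalizing a u with
  | nil => simp [pathParts, pathWeight]
  | cons w ws ih =>
    simp only [pathParts, pathWeight, List.map_cons, List.sum_cons, ih, List.length_cons]
    push_cast
    ring

lemma pathParts_injective {n : ℕ} (a : ℤ) (u : Fin (n + 1)) :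
    Function.Injective (pathParts a u) := by
  intro v w h
  have h' := congrArg (List.map Prod.snd) h
  rw [pathParts_map_snd, pathParts_map_snd] at h'
  exact List.map_injective_iff.2 Fin.val_injective (List.cons.inj h').2

lemma pathParts_isChain {n : ℕ} (ws : List (Fin (n + 1))) (a : ℤ) (u : Fin (n + 1)) :
    (pathParts a u ws).IsChain
      (fun y x : ℤ × ℕ => x.1 - y.1 = |(x.2 : ℤ) - (y.2 : ℤ)|) := by
  induction ws generalizing a u with
  | nil => simp [pathParts]
  | cons w ws ih =>
    have h := ih (a + |((w : ℕ) : ℤ) - ((u : ℕ) : ℤ)|) w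
    obtain ⟨l, hl⟩ := pathParts_eq_cons (a + |((w : ℕ) : ℤ) - ((u : ℕ) : ℤ)|) w ws
    rw [pathParts]
    rw [hl] at h ⊢
    exact List.isChain_cons_cons.2 ⟨by simp, h⟩

lemma exists_pathParts_eq {n : ℕ} (l : List (ℤ × ℕ)) (a : ℤ) (u : Fin (n + 1))
    (hn : ∀ p ∈ l, p.2 ≤ n)
    (hl : ((a, (u : ℕ)) :: l).IsChain
      (fun y x : ℤ × ℕ => x.1 - y.1 = |(x.2 : ℤ) - (y.2 : ℤ)|)) :
    ∃ ws, pathParts a u ws = (a, (u : ℕ)) :: l := by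
  induction l generalizing a u with
  | nil => exact ⟨[], rfl⟩
  | cons p l ih =>
    obtain ⟨b, v⟩ := p
    rw [List.isChain_cons_cons] at hl
    have hv : v ≤ n := hn (b, v) (by simp)
    obtain ⟨ws, hws⟩ := ih b ⟨v, by omega⟩ (fun p hp => hn p (by simp [hp])) hl.2
    refine ⟨⟨v, by omega⟩ :: ws, ?_⟩
    have hb : a + |(v : ℤ) - ((u : ℕ) : ℤ)| = b := by
      have := hl.1
      simp only at this
      omega
    simp only [pathParts, hb, hws]

/-- Colour sequences that do not start with the colour `i`. -/
def startNe {n : ℕ} (i : Fin (n + 1)) : Set (List (Fin (n + 1))) := {ws | ∀ w ∈ ws.head?, w ≠ i}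

lemma CeqSet_eq_image {n : ℕ} (i : Fin (n + 1)) (m : ℕ) :
    CeqSet n i m = (fun ws : startNe i => (pathParts 0 i ws.1).reverse) ''
      ((fun ws : startNe i => pathWeight i ws.1) ⁻¹' {m}) := by
  ext L
  constructor
  · rintro ⟨h1, h2, h3, h4, h5⟩
    obtain ⟨R, rfl⟩ : ∃ R : List (ℤ × ℕ), L = R.reverse := ⟨L.reverse, by simp⟩
    rw [List.getLast?_reverse] at h3
    obtain ⟨l, rfl⟩ : ∃ l, R = (0, (i : ℕ)) :: l := by
      cases R with
      | nil => simp at h3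
      | cons p l => simp at h3; exact ⟨l, by rw [h3]⟩
    obtain ⟨ws, hws⟩ := exists_pathParts_eq l 0 i (fun p hp => h1 p (by simp [hp]))
      (List.isChain_reverse.1 h2)
    rw [← hws] at h4 h5
    have hh : ws ∈ startNe i := by
      cases ws with
      | nil => simp [startNe]
      | cons w ws =>
        obtain ⟨t, ht⟩ := pathParts_eq_cons (0 + |((w : ℕ) : ℤ) - ((i : ℕ) : ℤ)|) w ws
        rw [pathParts, ht] at h4
        simp [Fin.val_inj] at h4
        simpa [startNe] using h4
    refine ⟨⟨ws, hh⟩, ?_, by simp [hws]⟩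
    rw [List.map_reverse, List.sum_reverse, pathParts_sum] at h5
    simp only [Set.mem_preimage, Set.mem_singleton_iff]
    simpa using h5
  · rintro ⟨⟨ws, hh⟩, hm, rfl⟩
    simp only [Set.mem_preimage, Set.mem_singleton_iff] at hm
    refine ⟨?_, ?_, ?_, ?_, ?_⟩
    · intro p hp
      have : p.2 ∈ (pathParts 0 i ws).map Prod.snd :=
        List.mem_map_of_mem (List.mem_reverse.1 hp)
      rw [pathParts_map_snd] at this
      simp only [List.mem_cons, List.mem_map] at this
      rcases this with h | ⟨w, -, h⟩ <;> omega
    · exact List.isChain_reverse.2 (pathParts_isChain ws 0 i)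
    · obtain ⟨l, hl⟩ := pathParts_eq_cons 0 i ws
      rw [List.getLast?_reverse, hl]
      rfl
    · cases ws with
      | nil => simp [pathParts]
      | cons w ws =>
        obtain ⟨t, ht⟩ := pathParts_eq_cons (0 + |((w : ℕ) : ℤ) - ((i : ℕ) : ℤ)|) w ws
        have ht' : pathParts 0 i (w :: ws) = _ := congrArg (List.cons (0, (i : ℕ))) ht
        simpa [ht', startNe, Fin.val_inj] using hh
    · rw [List.map_reverse, List.sum_reverse, pathParts_sum]
      simp [hm]

lemma Ceq_eq_card {n : ℕ} (i : Fin (n + 1)) (m : ℕ) :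
    Ceq n i m = Nat.card ((fun ws : startNe i => pathWeight i ws.1) ⁻¹' {m}) := by
  rw [Ceq, CeqSet_eq_image, Set.ncard_image_of_injective, Nat.card_coe_set_eq]
  intro v w h
  exact Subtype.ext (pathParts_injective 0 i (List.reverse_injective h))

/-- Adding a first entry to a list, as an embedding. -/
def consEmbedding (α : Type*) : α × List α ↪ List α where
  toFun p := p.1 :: p.2
  inj' _ _ h := Prod.ext (List.cons.inj h).1 (List.cons.inj h).2

@[simp]
lemma consEmbedding_apply {α : Type*} (a : α) (l : List α) :
    consEmbedding α (a, l) = a :: l := rfl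

/-- The lists of a given length over a finite alphabet. -/
def listsOfLength (α : Type*) [Fintype α] : ℕ → Finset (List α)
  | 0 => {[]}
  | s + 1 => (Finset.univ ×ˢ listsOfLength α s).map (consEmbedding α)

lemma mem_listsOfLength {α : Type*} [Fintype α] (s : ℕ) (l : List α) :
    l ∈ listsOfLength α s ↔ l.length = s := by
  induction s generalizing l with
  | zero => simp [listsOfLength]
  | succ s ih => cases l <;> simp [listsOfLength, ih]

/-- The lists of length at most a given bound over a finite alphabet. -/
def listsOfLengthLE (α : Type*) [Fintype α] [DecidableEq α] (s : ℕ) : Finset (List α) :=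
  (Finset.range (s + 1)).biUnion (listsOfLength α)

lemma mem_listsOfLengthLE {α : Type*} [Fintype α] [DecidableEq α] (s : ℕ) (l : List α) :
    l ∈ listsOfLengthLE α s ↔ l.length ≤ s := by
  simp [listsOfLengthLE, mem_listsOfLength]

lemma sum_listsOfLengthLE_succ {α M : Type*} [Fintype α] [DecidableEq α] [AddCommMonoid M]
    (f : List α → M) (s : ℕ) :
    ∑ l ∈ listsOfLengthLE α (s + 1), f l =
      ∑ l ∈ listsOfLengthLE α s, f l + ∑ l ∈ listsOfLength α (s + 1), f l := by
  rw [← Finset.sum_union]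
  · refine Finset.sum_congr ?_ fun _ _ => rfl
    ext l
    simp only [mem_listsOfLengthLE, Finset.mem_union, mem_listsOfLength]
    omega
  · rw [Finset.disjoint_left]
    intro l
    simp only [mem_listsOfLengthLE, mem_listsOfLength]
    omega

lemma tendsto_listsOfLengthLE (α : Type*) [Fintype α] [DecidableEq α] :
    Filter.Tendsto (listsOfLengthLE α) Filter.atTop Filter.atTop := by
  refine Monotone.tendsto_atTop_finset (fun s t hst l => ?_) fun l => ⟨l.length, ?_⟩
  · simp only [mem_listsOfLengthLE]
    omega
  · simp [mem_listsOfLengthLE]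

/-- The generating function of the weights of the colour sequences of length `s` above `j`. -/
def pathSum {n : ℕ} {R : Type*} [CommRing R] (q : R) : ℕ → Fin (n + 1) → R
  | 0, _ => 1
  | s + 1, j =>
    ∑ l : Fin (n + 1), q ^ ((s + 1) * (((l : ℕ) : ℤ) - ((j : ℕ) : ℤ)).natAbs) * pathSum q s l

lemma sum_pow_pathWeight {n : ℕ} {R : Type*} [CommRing R] (q : R) (s : ℕ) (j : Fin (n + 1)) :
    ∑ ws ∈ listsOfLength (Fin (n + 1)) s, q ^ pathWeight j ws = pathSum q s j := by
  induction s generalizing j with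
  | zero => simp [listsOfLength, pathWeight, pathSum]
  | succ s ih =>
    rw [listsOfLength, Finset.sum_map, Finset.sum_product, pathSum]
    refine Finset.sum_congr rfl fun l _ => ?_
    rw [← ih, Finset.mul_sum]
    refine Finset.sum_congr rfl fun ws hws => ?_
    rw [mem_listsOfLength] at hws
    simp [pathWeight, hws, pow_add]

lemma sum_indicator_startNe {n : ℕ} {R : Type*} [CommRing R] (q : R) (s : ℕ) (i : Fin (n + 1)) :
    ∑ ws ∈ listsOfLengthLE (Fin (n + 1)) s,
      (startNe i).indicator (fun ws => q ^ pathWeight i ws) ws = pathSum q s i := by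
  induction s with
  | zero => simp [listsOfLengthLE, listsOfLength, pathSum, startNe, pathWeight, Set.indicator_apply]
  | succ s ih =>
    rw [sum_listsOfLengthLE_succ, ih, ← sum_pow_pathWeight q (s + 1), listsOfLength,
      Finset.sum_map, Finset.sum_map, Finset.sum_product, Finset.sum_product,
      ← Finset.add_sum_erase _ _ (Finset.mem_univ i),
      ← Finset.add_sum_erase (a := i) _ _ (Finset.mem_univ i)]
    rw [← add_assoc]
    congr 1
    · rw [← sum_pow_pathWeight q s]
      simp [startNe, pathWeight]
    · refine Finset.sum_congr rfl fun l hl => Finset.sum_congr rfl fun ws _ => ?_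
      have hl' : l ≠ i := Finset.ne_of_mem_erase hl
      simp [startNe, hl', Set.indicator_apply]

lemma hasSum_Ceq {n : ℕ} (i : Fin (n + 1)) {q a : ℂ}
    (hs : Summable ((startNe i).indicator fun ws => q ^ pathWeight i ws))
    (ha : Filter.Tendsto (fun s => pathSum q s i) Filter.atTop (nhds a)) :
    HasSum (fun m => (Ceq n i m : ℂ) * q ^ m) a := by
  have h : HasSum ((startNe i).indicator fun ws => q ^ pathWeight i ws) a := by
    have h1 := hs.hasSum.comp (tendsto_listsOfLengthLE (Fin (n + 1)))
    have h2 : Filter.Tendsto (fun s => pathSum q s i) Filter.atTop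
        (nhds (∑' ws, (startNe i).indicator (fun ws => q ^ pathWeight i ws) ws)) := by
      refine h1.congr fun s => ?_
      exact sum_indicator_startNe q s i
    rw [tendsto_nhds_unique ha h2]
    exact hs.hasSum
  rw [← hasSum_subtype_iff_indicator] at h
  have h3 := h.tsum_fiberwise (fun ws : startNe i => pathWeight i ws.1)
  refine h3.congr_fun ?_
  intro m
  rw [Ceq_eq_card, ← nsmul_eq_mul, ← tsum_const]
  refine tsum_congr fun b => ?_
  have hb : pathWeight i b.1.1 = m := b.2
  simp [hb]

lemma summable_indicator_startNe {n : ℕ} (i : Fin (n + 1)) {r b : ℝ} (hr : 0 ≤ r)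
    (hb : ∀ s, pathSum r s i ≤ b) :
    Summable ((startNe i).indicator fun ws => r ^ pathWeight i ws) := by
  have h0 : 0 ≤ (startNe i).indicator fun ws => r ^ pathWeight i ws :=
    Set.indicator_nonneg fun _ _ => pow_nonneg hr _
  refine summable_of_sum_le h0 (c := b) fun u => ?_
  refine le_trans (Finset.sum_le_sum_of_subset_of_nonneg (t := listsOfLengthLE _ (u.sup List.length))
    (fun l hl => ?_) fun l _ _ => h0 l) ((sum_indicator_startNe r _ i).le.trans (hb _))
  rw [mem_listsOfLengthLE]
  exact Finset.le_sup (f := List.length) hl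

/-! ### Finite `q`-Pochhammer symbols -/

/-- The finite `q`-Pochhammer symbol `(a; q)_m`. -/
noncomputable def qPochFin (a q : ℂ) (m : ℕ) : ℂ := ∏ k ∈ Finset.range m, (1 - a * q ^ k)

lemma qPochFin_succ (a q : ℂ) (m : ℕ) :
    qPochFin a q (m + 1) = qPochFin a q m * (1 - a * q ^ m) :=
  Finset.prod_range_succ _ _

lemma one_sub_ne_zero_of_norm_lt_one {x : ℂ} (hx : ‖x‖ < 1) : 1 - x ≠ 0 := by
  intro h
  rw [← sub_eq_zero.1 h] at hx
  simp at hx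

lemma norm_mul_pow_lt_one {a q : ℂ} (ha : ‖a‖ < 1) (hq : ‖q‖ < 1) (k : ℕ) :
    ‖a * q ^ k‖ < 1 := by
  rw [norm_mul, norm_pow]
  exact (mul_le_of_le_one_right (norm_nonneg _) (pow_le_one₀ (norm_nonneg _) hq.le)).trans_lt ha

lemma qPochFin_ne_zero {a q : ℂ} (ha : ‖a‖ < 1) (hq : ‖q‖ < 1) (m : ℕ) : qPochFin a q m ≠ 0 :=
  Finset.prod_ne_zero_iff.2 fun k _ =>
    one_sub_ne_zero_of_norm_lt_one (norm_mul_pow_lt_one ha hq k)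

lemma summable_norm_mul_pow (a : ℂ) {q : ℂ} (hq : ‖q‖ < 1) :
    Summable fun k : ℕ => ‖-(a * q ^ k)‖ := by
  simp only [norm_neg, norm_mul, norm_pow]
  exact (summable_geometric_of_lt_one (norm_nonneg _) hq).mul_left _

lemma tendsto_qPochFin (a : ℂ) {q : ℂ} (hq : ‖q‖ < 1) :
    Filter.Tendsto (qPochFin a q) Filter.atTop (nhds (qPoch a q)) := by
  have h := (multipliable_one_add_of_summable
    (summable_norm_mul_pow a hq)).tendsto_prod_tprod_nat
  simp only [← sub_eq_add_neg] at h
  exact h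

lemma qPoch_ne_zero {a q : ℂ} (ha : ‖a‖ < 1) (hq : ‖q‖ < 1) : qPoch a q ≠ 0 := by
  have h := tprod_one_add_ne_zero_of_summable (f := fun k : ℕ => -(a * q ^ k))
    (fun k => by
      rw [← sub_eq_add_neg]
      exact one_sub_ne_zero_of_norm_lt_one (norm_mul_pow_lt_one ha hq k))
    (summable_norm_mul_pow a hq)
  simp only [← sub_eq_add_neg] at h
  exact h

lemma norm_sq_lt_one {q : ℂ} (hq : ‖q‖ < 1) : ‖q ^ 2‖ < 1 := by
  rw [norm_pow]
  exact pow_lt_one₀ (norm_nonneg _) hq two_ne_zero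

lemma qPochFin_two_mul (q : ℂ) (m : ℕ) :
    qPochFin q q (2 * m) = qPochFin q (q ^ 2) m * qPochFin (q ^ 2) (q ^ 2) m := by
  induction m with
  | zero => simp [qPochFin]
  | succ m ih =>
    rw [show 2 * (m + 1) = 2 * m + 1 + 1 by ring, qPochFin_succ, qPochFin_succ, ih,
      qPochFin_succ, qPochFin_succ]
    ring

lemma qPoch_self_eq_mul {q : ℂ} (hq : ‖q‖ < 1) :
    qPoch q q = qPoch q (q ^ 2) * qPoch (q ^ 2) (q ^ 2) := by
  have hq2 := norm_sq_lt_one hq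
  have h1 := (tendsto_qPochFin q hq).comp
    (Filter.tendsto_id.const_mul_atTop' (r := 2) two_pos)
  have h2 := (tendsto_qPochFin q hq2).mul (tendsto_qPochFin (q ^ 2) hq2)
  exact tendsto_nhds_unique h1 (h2.congr fun m => (qPochFin_two_mul q m).symm)

/-- The reciprocal of `(q; q)_k`, extended by zero to negative `k`. -/
noncomputable def invPoch (q : ℂ) (k : ℤ) : ℂ := if k < 0 then 0 else (qPochFin q q k.toNat)⁻¹

lemma invPoch_of_neg (q : ℂ) {k : ℤ} (hk : k < 0) : invPoch q k = 0 := if_pos hk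

lemma invPoch_of_nonneg (q : ℂ) {k : ℤ} (hk : 0 ≤ k) :
    invPoch q k = (qPochFin q q k.toNat)⁻¹ := if_neg (not_lt.2 hk)

lemma one_sub_mul_invPoch {q : ℂ} (hq : ‖q‖ < 1) (k : ℤ) :
    (1 - q ^ k) * invPoch q k = invPoch q (k - 1) := by
  rcases lt_trichotomy k 0 with hk | rfl | hk
  · rw [invPoch_of_neg q hk, invPoch_of_neg q (by omega), mul_zero]
  · rw [invPoch_of_neg q (by omega : (0 : ℤ) - 1 < 0)]
    simp
  · obtain ⟨m, rfl⟩ : ∃ m : ℕ, k = m + 1 := ⟨(k - 1).toNat, by omega⟩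
    rw [invPoch_of_nonneg q hk.le, invPoch_of_nonneg q (by omega),
      show ((m : ℤ) + 1).toNat = m + 1 by omega, show ((m : ℤ) + 1 - 1).toNat = m by omega,
      qPochFin_succ]
    have h1 := qPochFin_ne_zero hq hq m
    have h2 := one_sub_ne_zero_of_norm_lt_one (norm_mul_pow_lt_one hq hq m)
    have h3 : q ^ ((m : ℤ) + 1) = q * q ^ m := by
      rw [show (m : ℤ) + 1 = ((m + 1 : ℕ) : ℤ) by push_cast; rfl, zpow_natCast, pow_succ']
    rw [h3]
    field_simp

lemma tendsto_invPoch {q : ℂ} (hq : ‖q‖ < 1) :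
    Filter.Tendsto (invPoch q) Filter.atTop (nhds (qPoch q q)⁻¹) := by
  have h1 : Filter.Tendsto (fun k : ℤ => (qPochFin q q k.toNat)⁻¹) Filter.atTop
      (nhds (qPoch q q)⁻¹) := by
    refine ((tendsto_qPochFin q hq).comp ?_).inv₀ (qPoch_ne_zero hq hq)
    exact Filter.tendsto_atTop.2 fun b => Filter.eventually_atTop.2 ⟨b, fun k hk => by omega⟩
  refine h1.congr' ?_
  filter_upwards [Filter.eventually_ge_atTop 0] with k hk
  exact (invPoch_of_nonneg q hk).symm

lemma exists_norm_invPoch_le {q : ℂ} (hq : ‖q‖ < 1) : ∃ C, ∀ k, ‖invPoch q k‖ ≤ C := by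
  have h1 : Filter.Tendsto (fun m : ℕ => (qPochFin q q m)⁻¹) Filter.atTop
      (nhds (qPoch q q)⁻¹) := (tendsto_qPochFin q hq).inv₀ (qPoch_ne_zero hq hq)
  obtain ⟨C, hC⟩ := (Metric.isBounded_range_of_tendsto _ h1).exists_norm_le
  refine ⟨C, fun k => ?_⟩
  rcases lt_or_ge k 0 with hk | hk
  · rw [invPoch_of_neg q hk, norm_zero]
    exact (norm_nonneg _).trans (hC _ ⟨0, rfl⟩)
  · rw [invPoch_of_nonneg q hk]
    exact hC _ ⟨_, rfl⟩

/-! ### Truncated theta series -/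

/-- The term `(-1)^r Q^{r(r-1)/2} z^r` of the theta series. -/
noncomputable def thetaTerm (Q z : ℂ) (r : ℤ) : ℂ := (-1) ^ r * Q ^ (r * (r - 1) / 2) * z ^ r

lemma triangle_succ (r : ℤ) : (r + 1) * (r + 1 - 1) / 2 = r * (r - 1) / 2 + r := by
  rw [show (r + 1) * (r + 1 - 1) = r * (r - 1) + r * 2 by ring,
    Int.add_mul_ediv_right _ _ two_ne_zero]

lemma thetaTerm_add_one {Q z : ℂ} (hQ : Q ≠ 0) (hz : z ≠ 0) (r : ℤ) :
    thetaTerm Q z (r + 1) = -(thetaTerm Q z r * Q ^ r * z) := by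
  rw [thetaTerm, thetaTerm, triangle_succ, zpow_add₀ hQ, zpow_add₀ hz,
    zpow_add₀ (neg_ne_zero.2 one_ne_zero)]
  simp only [zpow_one]
  ring

lemma thetaTerm_mul (Q z w : ℂ) (r : ℤ) : thetaTerm Q (z * w) r = thetaTerm Q z r * w ^ r := by
  rw [thetaTerm, thetaTerm, mul_zpow]
  ring

lemma thetaTerm_ne_zero {Q z : ℂ} (hQ : Q ≠ 0) (hz : z ≠ 0) (r : ℤ) : thetaTerm Q z r ≠ 0 :=
  mul_ne_zero (mul_ne_zero (zpow_ne_zero _ (neg_ne_zero.2 one_ne_zero)) (zpow_ne_zero _ hQ))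
    (zpow_ne_zero _ hz)

lemma thetaTerm_one_sub (Q : ℂ) (r : ℤ) : thetaTerm Q 1 (1 - r) = -thetaTerm Q 1 r := by
  rw [thetaTerm, thetaTerm, show (1 - r) * (1 - r - 1) = r * (r - 1) by ring,
    zpow_sub₀ (neg_ne_zero.2 one_ne_zero)]
  have h : ((-1 : ℂ) ^ r)⁻¹ = (-1) ^ r := by rw [← inv_zpow, inv_neg, inv_one]
  rw [div_eq_mul_inv, h]
  simp

lemma thetaTerm_neg_one_sub {Q : ℂ} (hQ : Q ≠ 0) (r : ℤ) :
    thetaTerm Q Q (-1 - r) = -thetaTerm Q Q r := by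
  have key (s : ℤ) : thetaTerm Q Q s = -thetaTerm Q 1 (s + 1) := by
    rw [thetaTerm_add_one hQ one_ne_zero, ← thetaTerm_mul, one_mul, mul_one, neg_neg]
  rw [key, key, show -1 - r + 1 = 1 - (r + 1) by ring, thetaTerm_one_sub]

lemma summable_norm_thetaTerm {Q z : ℂ} (hQ : ‖Q‖ < 1) (hQ0 : Q ≠ 0) (hz : z ≠ 0) :
    Summable fun r => ‖thetaTerm Q z r‖ := by
  have hne := thetaTerm_ne_zero hQ0 hz
  have hp := tendsto_pow_atTop_nhds_zero_of_lt_one (norm_nonneg Q) hQ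
  refine Summable.of_nat_of_neg ?_ ?_
  · refine summable_of_ratio_test_tendsto_lt_one zero_lt_one
      (Filter.Eventually.of_forall fun k => norm_ne_zero_iff.2 (hne k)) ?_
    have h := hp.mul_const ‖z‖
    rw [zero_mul] at h
    refine h.congr fun k => ?_
    have := norm_ne_zero_iff.2 (hne k)
    push_cast
    rw [thetaTerm_add_one hQ0 hz]
    simp only [norm_norm, norm_neg, norm_mul, norm_pow, zpow_natCast]
    field_simp
  · refine summable_of_ratio_test_tendsto_lt_one zero_lt_one
      (Filter.Eventually.of_forall fun k => norm_ne_zero_iff.2 (hne (-k))) ?_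
    have h := (hp.comp (Filter.tendsto_add_atTop_nat 1)).mul_const ‖z‖⁻¹
    rw [zero_mul] at h
    refine h.congr fun k => ?_
    have h1 := norm_ne_zero_iff.2 (hne (-((k + 1 : ℕ) : ℤ)))
    have h2 := thetaTerm_add_one hQ0 hz (-((k + 1 : ℕ) : ℤ))
    rw [show -((k + 1 : ℕ) : ℤ) + 1 = -(k : ℤ) by push_cast; ring] at h2
    have h3 := norm_ne_zero_iff.2 hQ0
    have h4 := norm_ne_zero_iff.2 hz
    rw [h2]
    simp only [norm_norm, norm_neg, norm_mul, zpow_neg, zpow_natCast, norm_inv, norm_pow,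
      Function.comp_apply]
    field_simp

/-- The theta series with terms weighted by `1 / ((q; q)_{m-r} (q; q)_{m+r})`. -/
noncomputable def thetaTrunc (Q q z : ℂ) (m : ℕ) : ℂ :=
  ∑' r : ℤ, thetaTerm Q z r * (invPoch q (m - r) * invPoch q (m + r))

lemma invPoch_mul_invPoch_eq_zero (q : ℂ) {m r : ℤ} (hr : r ∉ Finset.Icc (-m) m) :
    invPoch q (m - r) * invPoch q (m + r) = 0 := by
  simp only [Finset.mem_Icc, not_and_or, not_le] at hr
  rcases hr with hr | hr
  · rw [invPoch_of_neg q (by omega : m + r < 0), mul_zero]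
  · rw [invPoch_of_neg q (by omega : m - r < 0), zero_mul]

lemma summable_mul_invPoch_mul_invPoch (q : ℂ) (m : ℤ) (f : ℤ → ℂ) :
    Summable fun r => f r * (invPoch q (m - r) * invPoch q (m + r)) :=
  summable_of_ne_finset_zero (s := Finset.Icc (-m) m) fun r hr => by
    rw [invPoch_mul_invPoch_eq_zero q hr, mul_zero]

lemma hasSum_thetaTrunc (Q q z : ℂ) (m : ℕ) :
    HasSum (fun r : ℤ => thetaTerm Q z r * (invPoch q (m - r) * invPoch q (m + r)))
      (thetaTrunc Q q z m) :=
  (summable_mul_invPoch_mul_invPoch q m _).hasSum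

lemma tendsto_thetaTrunc {Q q z : ℂ} (hQ : ‖Q‖ < 1) (hQ0 : Q ≠ 0) (hz : z ≠ 0) (hq : ‖q‖ < 1) :
    Filter.Tendsto (thetaTrunc Q q z) Filter.atTop
      (nhds ((∑' r, thetaTerm Q z r) * ((qPoch q q)⁻¹ * (qPoch q q)⁻¹))) := by
  obtain ⟨C, hC⟩ := exists_norm_invPoch_le hq
  have hC0 : 0 ≤ C := (norm_nonneg _).trans (hC 0)
  rw [← tsum_mul_right]
  refine tendsto_tsum_of_dominated_convergence
    ((summable_norm_thetaTerm hQ hQ0 hz).mul_right (C * C)) (fun r => ?_)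
    (Filter.Eventually.of_forall fun m r => ?_)
  · refine Filter.Tendsto.const_mul _ (((tendsto_invPoch hq).comp ?_).mul
      ((tendsto_invPoch hq).comp ?_))
    · exact Filter.tendsto_atTop_add_const_right _ (-r) tendsto_natCast_atTop_atTop
    · exact Filter.tendsto_atTop_add_const_right _ r tendsto_natCast_atTop_atTop
  · rw [norm_mul, norm_mul]
    gcongr
    · exact hC _
    · exact hC _

lemma thetaTrunc_eq_combination {Q q z : ℂ} (hq : ‖q‖ < 1) (hq0 : q ≠ 0) (m : ℕ) :
    thetaTrunc Q q z m =
      (1 + q ^ (2 * (m + 1))) * thetaTrunc Q q z (m + 1) -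
        q ^ (m + 1) * thetaTrunc Q q (z * q⁻¹) (m + 1) -
        q ^ (m + 1) * thetaTrunc Q q (z * q) (m + 1) := by
  refine (hasSum_thetaTrunc Q q z m).unique ?_
  refine ((((hasSum_thetaTrunc Q q z (m + 1)).mul_left _).sub
    ((hasSum_thetaTrunc Q q (z * q⁻¹) (m + 1)).mul_left _)).sub
    ((hasSum_thetaTrunc Q q (z * q) (m + 1)).mul_left _)).congr_fun fun r => ?_
  have h1 := one_sub_mul_invPoch hq ((m + 1 : ℕ) - r)
  have h2 := one_sub_mul_invPoch hq ((m + 1 : ℕ) + r)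
  rw [show ((m + 1 : ℕ) : ℤ) - r - 1 = m - r by push_cast; ring] at h1
  rw [show ((m + 1 : ℕ) : ℤ) + r - 1 = m + r by push_cast; ring] at h2
  rw [← h1, ← h2, thetaTerm_mul, thetaTerm_mul, inv_zpow, zpow_sub₀ hq0, zpow_add₀ hq0,
    zpow_natCast]
  have h3 := zpow_ne_zero r hq0
  field_simp
  ring

lemma tsum_eq_zero_of_antisymm {f : ℤ → ℂ} (c : ℤ) (h : ∀ r, f (c - r) = -f r) :
    ∑' r, f r = 0 := by
  have h1 := (Equiv.subLeft c).tsum_eq f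
  simp only [Equiv.subLeft_apply, h, tsum_neg] at h1
  exact self_eq_neg.1 h1.symm

lemma thetaTrunc_one (Q : ℂ) {q : ℂ} (hq : ‖q‖ < 1) (hq0 : q ≠ 0) (m : ℕ) :
    thetaTrunc Q q 1 m = q ^ m * thetaTrunc Q q q m := by
  rw [← sub_eq_zero]
  have h := (hasSum_thetaTrunc Q q 1 m).sub ((hasSum_thetaTrunc Q q q m).mul_left (q ^ m))
  rw [← h.tsum_eq]
  have hf (r : ℤ) : thetaTerm Q 1 r * (invPoch q (m - r) * invPoch q (m + r)) -
      q ^ m * (thetaTerm Q q r * (invPoch q (m - r) * invPoch q (m + r))) =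
      thetaTerm Q 1 r * (invPoch q (m - r) * invPoch q (m + r - 1)) := by
    rw [← one_sub_mul_invPoch hq, zpow_add₀ hq0, zpow_natCast, ← one_mul q, thetaTerm_mul,
      one_mul q]
    ring
  simp only [hf]
  refine tsum_eq_zero_of_antisymm 1 fun r => ?_
  rw [thetaTerm_one_sub, show (m : ℤ) - (1 - r) = m + r - 1 by ring,
    show (m : ℤ) + (1 - r) - 1 = m - r by ring]
  ring

lemma thetaTrunc_self {Q q : ℂ} (hQ0 : Q ≠ 0) (hq : ‖q‖ < 1) (hq0 : q ≠ 0) (m : ℕ) :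
    thetaTrunc Q q Q m = q ^ m * thetaTrunc Q q (Q * q⁻¹) m := by
  rw [← sub_eq_zero]
  have h := (hasSum_thetaTrunc Q q Q m).sub
    ((hasSum_thetaTrunc Q q (Q * q⁻¹) m).mul_left (q ^ m))
  rw [← h.tsum_eq]
  have hf (r : ℤ) : thetaTerm Q Q r * (invPoch q (m - r) * invPoch q (m + r)) -
      q ^ m * (thetaTerm Q (Q * q⁻¹) r * (invPoch q (m - r) * invPoch q (m + r))) =
      thetaTerm Q Q r * (invPoch q (m - r - 1) * invPoch q (m + r)) := by
    rw [← one_sub_mul_invPoch hq, zpow_sub₀ hq0, zpow_natCast, thetaTerm_mul, inv_zpow]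
    ring
  simp only [hf]
  refine tsum_eq_zero_of_antisymm (-1) fun r => ?_
  rw [thetaTerm_neg_one_sub hQ0, show (m : ℤ) - (-1 - r) - 1 = m + r by ring,
    show (m : ℤ) + (-1 - r) = m - r - 1 by ring]
  ring

/-! ### The Jacobi triple product -/

lemma thetaTrunc_succ_self_base {Q z w : ℂ} (hQ : ‖Q‖ < 1) (hQ0 : Q ≠ 0) (hzw : z * w = Q)
    (m : ℕ) :
    (1 - Q ^ (2 * m + 1)) * (1 - Q ^ (2 * m + 2)) * thetaTrunc Q Q z (m + 1) =
      (1 - z * Q ^ m) * (1 - w * Q ^ m) * thetaTrunc Q Q z m := by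
  have hz : z ≠ 0 := left_ne_zero_of_mul (hzw ▸ hQ0)
  have hw : w ≠ 0 := right_ne_zero_of_mul (hzw ▸ hQ0)
  have h0 := hasSum_thetaTrunc Q Q z m
  have hp := (Equiv.addRight (1 : ℤ)).hasSum_iff.2 h0
  have hm := (Equiv.addRight (-1 : ℤ)).hasSum_iff.2 h0
  have h := ((h0.mul_left (1 + Q ^ (2 * m + 1))).sub (hm.mul_left (z * Q ^ m))).sub
    (hp.mul_left (w * Q ^ m))
  have e : (1 - z * Q ^ m) * (1 - w * Q ^ m) * thetaTrunc Q Q z m =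
      (1 + Q ^ (2 * m + 1)) * thetaTrunc Q Q z m - z * Q ^ m * thetaTrunc Q Q z m -
        w * Q ^ m * thetaTrunc Q Q z m := by
    linear_combination (Q ^ (2 * m) * thetaTrunc Q Q z m) * hzw
  rw [e]
  refine ((hasSum_thetaTrunc Q Q z (m + 1)).mul_left _).unique (h.congr_fun fun r => ?_)
  simp only [Function.comp_apply, Equiv.coe_addRight]
  have ht1 := thetaTerm_add_one hQ0 hz r
  have ht2 := thetaTerm_add_one hQ0 hz (r + -1)
  rw [neg_add_cancel_right, zpow_add₀ hQ0, zpow_neg_one] at ht2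
  have ha := one_sub_mul_invPoch hQ ((m + 1 : ℕ) - r)
  have ha' := one_sub_mul_invPoch hQ ((m : ℤ) - r)
  have hb := one_sub_mul_invPoch hQ ((m + 1 : ℕ) + r)
  have hb' := one_sub_mul_invPoch hQ ((m : ℤ) + r)
  rw [show ((m + 1 : ℕ) : ℤ) - r - 1 = m - r by push_cast; ring] at ha
  rw [show ((m + 1 : ℕ) : ℤ) + r - 1 = m + r by push_cast; ring] at hb
  rw [show (m : ℤ) - (r + 1) = m - r - 1 by ring, show (m : ℤ) + (r + -1) = m + r - 1 by ring,
    show (m : ℤ) - (r + -1) = (m + 1 : ℕ) - r by push_cast; ring,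
    show (m : ℤ) + (r + 1) = (m + 1 : ℕ) + r by push_cast; ring, ← ha', ← hb', ← ha, ← hb, ht1,
    ht2]
  have hr := zpow_ne_zero r hQ0
  simp only [zpow_sub₀ hQ0, zpow_add₀ hQ0, zpow_natCast]
  rw [← hzw] at *
  field_simp
  ring

lemma thetaTrunc_zero (Q q z : ℂ) : thetaTrunc Q q z 0 = 1 := by
  rw [thetaTrunc, tsum_eq_single 0]
  · simp [thetaTerm, invPoch, qPochFin]
  · intro r hr
    rw [Nat.cast_zero, invPoch_mul_invPoch_eq_zero q (by simpa using hr), mul_zero]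

lemma qPochFin_mul_thetaTrunc {Q z w : ℂ} (hQ : ‖Q‖ < 1) (hQ0 : Q ≠ 0) (hzw : z * w = Q)
    (m : ℕ) :
    qPochFin Q Q (2 * m) * thetaTrunc Q Q z m = qPochFin z Q m * qPochFin w Q m := by
  induction m with
  | zero => simp [thetaTrunc_zero, qPochFin]
  | succ m ih =>
    rw [show 2 * (m + 1) = 2 * m + 1 + 1 by ring, qPochFin_succ, qPochFin_succ,
      qPochFin_succ z, qPochFin_succ w]
    linear_combination qPochFin Q Q (2 * m) * thetaTrunc_succ_self_base hQ hQ0 hzw m +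
      (1 - z * Q ^ m) * (1 - w * Q ^ m) * ih

/-- The Jacobi triple product identity. -/
lemma tsum_thetaTerm {Q z w : ℂ} (hQ : ‖Q‖ < 1) (hQ0 : Q ≠ 0) (hzw : z * w = Q) :
    ∑' r, thetaTerm Q z r = qPoch z Q * qPoch w Q * qPoch Q Q := by
  have hz : z ≠ 0 := left_ne_zero_of_mul (hzw ▸ hQ0)
  have h1 := ((tendsto_qPochFin Q hQ).comp
    (Filter.tendsto_id.const_mul_atTop' (r := 2) two_pos)).mul (tendsto_thetaTrunc hQ hQ0 hz hQ)
  have h2 := (tendsto_qPochFin z hQ).mul (tendsto_qPochFin w hQ)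
  have h3 := tendsto_nhds_unique h1
    (h2.congr fun m => (qPochFin_mul_thetaTrunc hQ hQ0 hzw m).symm)
  have h4 := qPoch_ne_zero hQ hQ
  rw [← h3]
  field_simp

/-! ### The closed form of the path generating functions -/

lemma sum_pow_mul_second_difference (x : ℂ) (p : ℤ → ℂ) (j k : ℕ) (h0 : p (-1) = x * p 0)
    (hn : p (j + k + 1) = x * p (j + k)) :
    ∑ l ∈ Finset.range (j + 1 + k), x ^ ((l : ℤ) - (j : ℤ)).natAbs *
      ((1 + x ^ 2) * p l - x * p (l - 1) - x * p (l + 1)) = (1 - x ^ 2) * p j := by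
  have hl (t : ℕ) : ∑ l ∈ Finset.range t, x ^ (t - l) *
      ((1 + x ^ 2) * p l - x * p (l - 1) - x * p (l + 1)) = x * (p (t - 1) - x * p t) := by
    induction t with
    | zero => simp [h0]
    | succ t ih =>
      rw [Finset.sum_range_succ]
      have : ∀ l ∈ Finset.range t, x ^ (t + 1 - l) *
          ((1 + x ^ 2) * p l - x * p (l - 1) - x * p (l + 1)) = x * (x ^ (t - l) *
          ((1 + x ^ 2) * p l - x * p (l - 1) - x * p (l + 1))) := fun l hl => by
        rw [Nat.succ_sub (Finset.mem_range.1 hl).le, pow_succ]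
        ring
      rw [Finset.sum_congr rfl this, ← Finset.mul_sum, ih]
      push_cast
      rw [add_sub_cancel_right, Nat.add_sub_cancel_left, pow_one]
      ring
  have hr (t : ℕ) : ∑ l ∈ Finset.range t, x ^ (l + 1) *
      ((1 + x ^ 2) * p (j + 1 + l) - x * p (j + 1 + l - 1) - x * p (j + 1 + l + 1)) =
      x * (p (j + 1) - x * p j) - x ^ (t + 1) * (p (j + t + 1) - x * p (j + t)) := by
    induction t with
    | zero => simp
    | succ t ih =>
      rw [Finset.sum_range_succ, ih]
      push_cast
      rw [show (j : ℤ) + 1 + t - 1 = j + t by ring, show (j : ℤ) + 1 + t = j + t + 1 by ring,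
        show (j : ℤ) + (t + 1) = j + t + 1 by ring]
      ring
  rw [Finset.sum_range_add, Finset.sum_range_succ]
  have h1 : ∀ l ∈ Finset.range j, x ^ ((l : ℤ) - (j : ℤ)).natAbs *
      ((1 + x ^ 2) * p l - x * p (l - 1) - x * p (l + 1)) = x ^ (j - l) *
      ((1 + x ^ 2) * p l - x * p (l - 1) - x * p (l + 1)) := fun l hl => by
    rw [Finset.mem_range] at hl
    rw [show ((l : ℤ) - (j : ℤ)).natAbs = j - l by omega]
  have h2 : ∀ l ∈ Finset.range k, x ^ (((j + 1 + l : ℕ) : ℤ) - (j : ℤ)).natAbs *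
      ((1 + x ^ 2) * p (j + 1 + l : ℕ) - x * p ((j + 1 + l : ℕ) - 1) -
        x * p ((j + 1 + l : ℕ) + 1)) = x ^ (l + 1) *
      ((1 + x ^ 2) * p (j + 1 + l) - x * p (j + 1 + l - 1) - x * p (j + 1 + l + 1)) :=
    fun l _ => by
      rw [show (((j + 1 + l : ℕ) : ℤ) - (j : ℤ)).natAbs = l + 1 by omega]
      push_cast
      rfl
  rw [Finset.sum_congr rfl h1, Finset.sum_congr rfl h2, hl, hr, hn]
  simp
  ring

lemma pathSum_eq {n : ℕ} {q : ℂ} (hq : ‖q‖ < 1) (hq0 : q ≠ 0) (s : ℕ) (j : Fin (n + 1)) :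
    pathSum q s j =
      qPochFin (q ^ 2) (q ^ 2) s * thetaTrunc (q ^ (n + 2)) q (q ^ ((j : ℤ) + 1)) s := by
  induction s generalizing j with
  | zero => simp [pathSum, thetaTrunc_zero, qPochFin]
  | succ s ih =>
    have hQ0 : q ^ (n + 2) ≠ 0 := pow_ne_zero _ hq0
    set p : ℤ → ℂ := fun l => thetaTrunc (q ^ (n + 2)) q (q ^ (l + 1)) (s + 1) with hp
    have h0 : p (-1) = q ^ (s + 1) * p 0 := by
      simpa [hp] using thetaTrunc_one (q ^ (n + 2)) hq hq0 (s + 1)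
    have hn : p (n + 1) = q ^ (s + 1) * p n := by
      have h := thetaTrunc_self hQ0 hq hq0 (s + 1)
      have e1 : q ^ (n + 2) * q⁻¹ = q ^ ((n : ℤ) + 1) := by
        rw [← zpow_natCast, ← zpow_sub_one₀ hq0]
        congr 1
        push_cast
        ring
      have e2 : q ^ (n + 2) = q ^ ((n : ℤ) + 1 + 1) := by
        rw [← zpow_natCast]
        congr 1
      rw [e1] at h
      simp only [hp]
      rw [← e2, h]
    obtain ⟨j, hj⟩ := j
    obtain ⟨k, rfl⟩ : ∃ k, n = j + k := ⟨n - j, by omega⟩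
    have key := sum_pow_mul_second_difference (q ^ (s + 1)) p j k h0 (by exact_mod_cast hn)
    have hstep (l : ℕ) : thetaTrunc (q ^ (j + k + 2)) q (q ^ ((l : ℤ) + 1)) s =
        (1 + (q ^ (s + 1)) ^ 2) * p l - q ^ (s + 1) * p (l - 1) - q ^ (s + 1) * p (l + 1) := by
      rw [thetaTrunc_eq_combination hq hq0, ← zpow_sub_one₀ hq0, ← zpow_add_one₀ hq0]
      simp only [hp]
      rw [show (l : ℤ) + 1 - 1 = l - 1 + 1 by ring]
      ring
    rw [pathSum, qPochFin_succ]
    simp only [ih, hstep]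
    have hsum := Fin.sum_univ_eq_sum_range (fun l : ℕ =>
      q ^ ((s + 1) * ((l : ℤ) - (j : ℤ)).natAbs) * (qPochFin (q ^ 2) (q ^ 2) s *
        ((1 + (q ^ (s + 1)) ^ 2) * p l - q ^ (s + 1) * p (l - 1) - q ^ (s + 1) * p (l + 1))))
      (j + k + 1)
    rw [hsum, show j + k + 1 = j + 1 + k by ring, mul_assoc,
      show 1 - q ^ 2 * (q ^ 2) ^ s = 1 - (q ^ (s + 1)) ^ 2 by ring, ← key, Finset.mul_sum]
    refine Finset.sum_congr rfl fun l _ => ?_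
    rw [pow_mul]
    ring

lemma tendsto_pathSum {n : ℕ} {q : ℂ} (hq : ‖q‖ < 1) (hq0 : q ≠ 0) (i : Fin (n + 1)) :
    Filter.Tendsto (fun s => pathSum q s i) Filter.atTop
      (nhds (qPoch (q ^ ((i : ℕ) + 1)) (q ^ (n + 2)) * qPoch (q ^ (n - i + 1)) (q ^ (n + 2)) *
        qPoch (q ^ (n + 2)) (q ^ (n + 2)) / (qPoch q (q ^ 2) * qPoch q q))) := by
  have hQ0 : q ^ (n + 2) ≠ 0 := pow_ne_zero _ hq0
  have hQ : ‖q ^ (n + 2)‖ < 1 := by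
    rw [norm_pow]
    exact pow_lt_one₀ (norm_nonneg _) hq (by omega)
  have hz : q ^ ((i : ℕ) + 1) ≠ 0 := pow_ne_zero _ hq0
  have hzw : q ^ ((i : ℕ) + 1) * q ^ (n - i + 1) = q ^ (n + 2) := by
    rw [← pow_add]
    congr 1
    have := i.2
    omega
  have h := (tendsto_qPochFin (q ^ 2) (norm_sq_lt_one hq)).mul (tendsto_thetaTrunc hQ hQ0 hz hq)
  rw [tsum_thetaTerm hQ hQ0 hzw] at h
  convert h using 1
  · ext s
    rw [pathSum_eq hq hq0, ← Nat.cast_succ, zpow_natCast]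
  · congr 1
    have h1 := qPoch_ne_zero hq (norm_sq_lt_one hq)
    have h2 := qPoch_ne_zero (norm_sq_lt_one hq) (norm_sq_lt_one hq)
    rw [qPoch_self_eq_mul hq]
    field_simp

lemma pathSum_zero_left {n : ℕ} (s : ℕ) (j : Fin (n + 1)) : pathSum (0 : ℂ) s j = 1 := by
  induction s generalizing j with
  | zero => rfl
  | succ s ih =>
    rw [pathSum, Finset.sum_eq_single j]
    · simp [ih]
    · intro l _ hl
      have : ((l : ℕ) : ℤ) - ((j : ℕ) : ℤ) ≠ 0 := by
        have := Fin.val_ne_of_ne hl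
        omega
      rw [zero_pow (mul_ne_zero s.succ_ne_zero (Int.natAbs_ne_zero.2 this)), zero_mul]
    · simp

lemma ofReal_pathSum {n : ℕ} (r : ℝ) (s : ℕ) (j : Fin (n + 1)) :
    ((pathSum r s j : ℝ) : ℂ) = pathSum (r : ℂ) s j := by
  induction s generalizing j with
  | zero => simp [pathSum]
  | succ s ih => simp [pathSum, ih]

lemma summable_pow_pathWeight {n : ℕ} {q : ℂ} (hq : ‖q‖ < 1) (i : Fin (n + 1)) :
    Summable ((startNe i).indicator fun ws => q ^ pathWeight i ws) := by
  obtain ⟨r, hr, hr1⟩ := exists_between hq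
  have hr0 : 0 < r := (norm_nonneg q).trans_lt hr
  have h := tendsto_pathSum (q := (r : ℂ)) (by simpa [abs_of_pos hr0] using hr1)
    (by exact_mod_cast hr0.ne') i
  obtain ⟨C, hC⟩ := (Metric.isBounded_range_of_tendsto _ h).exists_norm_le
  have hb (s : ℕ) : pathSum r s i ≤ C := by
    have := hC _ ⟨s, rfl⟩
    simp only [← ofReal_pathSum, Complex.norm_real] at this
    exact (Real.le_norm_self _).trans this
  refine Summable.of_norm_bounded (summable_indicator_startNe i hr0.le hb) fun ws => ?_
  rw [norm_indicator_eq_indicator_norm]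
  refine Set.indicator_le_indicator ?_
  rw [norm_pow]
  exact pow_le_pow_left₀ (norm_nonneg _) hr.le _

/-- Theorem 1.7, equation (1.6): for `0 ≤ i ≤ n`,
`∑_{m≥0} C_{i,n}(m) qᵐ = (q^{i+1}, q^{n−i+1}, q^{n+2}; q^{n+2})_∞ / ((q;q²)_∞ (q;q)_∞)`. -/
theorem agCompanion (n i : ℕ) (hi : i ≤ n) (q : ℂ) (hq : ‖q‖ < 1) :
    ∑' m : ℕ, (Ceq n i m : ℂ) * q ^ m =
      qPoch (q ^ (i + 1)) (q ^ (n + 2)) * qPoch (q ^ (n - i + 1)) (q ^ (n + 2)) *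
        qPoch (q ^ (n + 2)) (q ^ (n + 2)) /
      (qPoch q (q ^ 2) * qPoch q q) := by
  set j : Fin (n + 1) := ⟨i, Nat.lt_succ_of_le hi⟩
  have hs := summable_pow_pathWeight hq j
  rcases eq_or_ne q 0 with rfl | hq0
  · have h : Filter.Tendsto (fun s => pathSum (0 : ℂ) s j) Filter.atTop (nhds 1) := by
      simp only [pathSum_zero_left]
      exact tendsto_const_nhds
    refine (hasSum_Ceq j hs h).tsum_eq.trans ?_
    simp [qPoch]
  · exact (hasSum_Ceq j hs (tendsto_pathSum hq hq0 j)).tsum_eq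
end

section
/- For all integers n ≥ 0 and 0 ≤ i ≤ n, one has the identity of formal power series in q: ∑_{m≥0} C^≥_{i,n}(m) q^m = (q^{i+1}, q^{n−i+1}, q^{n+2}; q^{n+2})_∞ / ((q; q²)_∞ (q; q)²_∞). -/
open scoped BigOperators

/-- The set of `(n+1)`-coloured partitions (lists of pairs (part, colour) with colours in
`{0,…,n}`) such that consecutive parts satisfy `λ_j − λ_{j+1} ≥ |u_j − u_{j+1}|`, the last part
is `0` with colour `i`, the penultimate part (if it exists) is not equal to `0` with colour `i`,
and the weight (sum of the parts) is `m`. -/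
def CgeSet (n i m : ℕ) : Set (List (ℤ × ℕ)) :=
  {L | (∀ p ∈ L, p.2 ≤ n) ∧
       List.Chain' (fun x y => x.1 - y.1 ≥ |(x.2 : ℤ) - (y.2 : ℤ)|) L ∧
       L.getLast? = some (0, i) ∧
       (∀ p ∈ L.reverse[1]?, p ≠ ((0 : ℤ), i)) ∧
       (L.map Prod.fst).sum = (m : ℤ)}

/-- `C^≥_{i,n}(m)`: the number of such coloured partitions of weight `m`. -/
noncomputable def Cge (n i m : ℕ) : ℕ := (CgeSet n i m).ncard

namespace AGCompanion

open Filter Topology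

/-! ### Finite `q`-products and truncated theta series -/

/-- The finite `q`-Pochhammer symbol `(a; q)_N`. -/
noncomputable def qPochFin (a q : ℂ) (N : ℕ) : ℂ := ∏ k ∈ Finset.range N, (1 - a * q ^ k)

/-- `1 / (q; q)_m`, extended by zero to negative `m`. -/
noncomputable def qFacInv (q : ℂ) : ℤ → ℂ
  | Int.ofNat m => (qPochFin q q m)⁻¹
  | Int.negSucc _ => 0

/-- The centred `q`-binomial coefficient `[2N, N + k]`, divided by `(q; q)_{2N}`. -/
noncomputable def qBinom (q : ℂ) (N : ℕ) (k : ℤ) : ℂ := qFacInv q (N + k) * qFacInv q (N - k)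

/-- The binomial coefficient `k (k - 1) / 2`. -/
def tri (k : ℤ) : ℤ := k * (k - 1) / 2

/-- The general term `(-1)ᵏ p^{k (k - 1) / 2} zᵏ` of the theta series. -/
noncomputable def thetaTerm (p z : ℂ) (k : ℤ) : ℂ := (-1) ^ k * p ^ tri k * z ^ k

lemma two_mul_tri (k : ℤ) : 2 * tri k = k * (k - 1) :=
  Int.mul_ediv_cancel' (Int.even_mul_pred_self k).two_dvd

lemma tri_add_one (k : ℤ) : tri (k + 1) = tri k + k := by
  have h1 := two_mul_tri (k + 1)
  have h2 := two_mul_tri k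
  linarith

lemma tri_one_sub (k : ℤ) : tri (1 - k) = tri k := by
  have h1 := two_mul_tri (1 - k)
  have h2 := two_mul_tri k
  linarith

lemma one_sub_pow_ne_zero {q : ℂ} (hq : ‖q‖ < 1) (m : ℕ) : 1 - q ^ (m + 1) ≠ 0 := by
  intro h
  have h1 : ‖q ^ (m + 1)‖ = 1 := by rw [← sub_eq_zero.mp h, norm_one]
  rw [norm_pow] at h1
  exact (pow_lt_one₀ (norm_nonneg q) hq (Nat.succ_ne_zero m)).ne h1

lemma qPochFin_succ (a q : ℂ) (N : ℕ) :
    qPochFin a q (N + 1) = qPochFin a q N * (1 - a * q ^ N) := Finset.prod_range_succ _ _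

lemma qPochFin_self_ne_zero {q : ℂ} (hq : ‖q‖ < 1) (N : ℕ) : qPochFin q q N ≠ 0 := by
  refine Finset.prod_ne_zero_iff.mpr fun k _ => ?_
  rw [← pow_succ']
  exact one_sub_pow_ne_zero hq k

lemma qFacInv_natCast (q : ℂ) (m : ℕ) : qFacInv q (m : ℤ) = (qPochFin q q m)⁻¹ := rfl

lemma qFacInv_of_neg (q : ℂ) {m : ℤ} (hm : m < 0) : qFacInv q m = 0 := by
  obtain ⟨k, rfl⟩ := Int.eq_negSucc_of_lt_zero hm
  rfl

lemma qFacInv_sub_one {q : ℂ} (hq : ‖q‖ < 1) (m : ℤ) :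
    qFacInv q (m - 1) = (1 - q ^ m) * qFacInv q m := by
  rcases lt_trichotomy m 0 with hm | rfl | hm
  · rw [qFacInv_of_neg q hm, qFacInv_of_neg q (by omega), mul_zero]
  · rw [qFacInv_of_neg q (by omega)]
    simp
  · obtain ⟨k, rfl⟩ : ∃ k : ℕ, m = (k : ℤ) + 1 := ⟨(m - 1).toNat, by omega⟩
    have h1 : ((k : ℤ) + 1) = ((k + 1 : ℕ) : ℤ) := by push_cast; ring
    rw [add_sub_cancel_right, h1, qFacInv_natCast, qFacInv_natCast, qPochFin_succ, zpow_natCast,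
      ← pow_succ']
    have h2 := one_sub_pow_ne_zero hq k
    have h3 := qPochFin_self_ne_zero hq k
    field_simp

lemma qBinom_eq_zero (q : ℂ) {N : ℕ} {k : ℤ} (hk : k ∉ Finset.Icc (-(N : ℤ)) N) :
    qBinom q N k = 0 := by
  rw [Finset.mem_Icc, not_and_or, not_le, not_le] at hk
  rcases hk with hk | hk
  · rw [qBinom, qFacInv_of_neg q (by omega), zero_mul]
  · rw [qBinom, qFacInv_of_neg q (m := N - k) (by omega), mul_zero]

lemma qBinom_neg (q : ℂ) (N : ℕ) (k : ℤ) : qBinom q N (-k) = qBinom q N k := by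
  rw [qBinom, qBinom, mul_comm, sub_neg_eq_add, ← sub_eq_add_neg]

lemma summable_mul_qBinom (q : ℂ) (N : ℕ) (w : ℤ → ℂ) :
    Summable fun k => w k * qBinom q N k :=
  summable_of_ne_finset_zero (s := Finset.Icc (-(N : ℤ)) N) fun k hk => by
    rw [qBinom_eq_zero q hk, mul_zero]

lemma qBinom_pred {q : ℂ} (hq : ‖q‖ < 1) (N : ℕ) (k : ℤ) :
    qBinom q N k
      = (1 - q ^ ((N : ℤ) + 1 + k)) * (1 - q ^ ((N : ℤ) + 1 - k)) * qBinom q (N + 1) k := by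
  have h1 := qFacInv_sub_one hq ((N : ℤ) + 1 + k)
  have h2 := qFacInv_sub_one hq ((N : ℤ) + 1 - k)
  rw [show (N : ℤ) + 1 + k - 1 = N + k by ring] at h1
  rw [show (N : ℤ) + 1 - k - 1 = N - k by ring] at h2
  rw [qBinom, qBinom, h1, h2]
  push_cast
  ring

lemma qBinom_shift {q : ℂ} (hq : ‖q‖ < 1) (N : ℕ) (k : ℤ) :
    qBinom q N (k - 1)
      = (1 - q ^ ((N : ℤ) + k)) * (1 - q ^ ((N : ℤ) + 1 + k)) * qBinom q (N + 1) k := by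
  have h1 := qFacInv_sub_one hq ((N : ℤ) + 1 + k)
  have h2 := qFacInv_sub_one hq ((N : ℤ) + k)
  rw [show (N : ℤ) + 1 + k - 1 = N + k by ring] at h1
  rw [qBinom, qBinom, show (N : ℤ) + (k - 1) = N + k - 1 by ring, h2, h1,
    show (N : ℤ) - (k - 1) = N + 1 - k by ring]
  push_cast
  ring

lemma thetaTerm_add_one {p z : ℂ} (hp : p ≠ 0) (hz : z ≠ 0) (k : ℤ) :
    thetaTerm p z (k + 1) = -(p ^ k * z * thetaTerm p z k) := by
  rw [thetaTerm, thetaTerm, tri_add_one, zpow_add₀ hp, zpow_add_one₀ hz,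
    zpow_add_one₀ (neg_ne_zero.mpr one_ne_zero)]
  ring

/-- The truncated theta series. -/
noncomputable def thetaTrunc (q p z : ℂ) (N : ℕ) : ℂ := ∑' k : ℤ, thetaTerm p z k * qBinom q N k

lemma thetaTrunc_self_succ {p z : ℂ} (hp : p ≠ 0) (hp1 : ‖p‖ < 1) (hz : z ≠ 0) (N : ℕ) :
    (1 - z * p ^ N) * (1 - p / z * p ^ N) * thetaTrunc p p z N
      = (1 - p * p ^ (2 * N)) * (1 - p * p ^ (2 * N + 1)) * thetaTrunc p p z (N + 1) := by
  have hup : z * thetaTrunc p p z N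
      = ∑' k : ℤ, -(p ^ (1 - k) * thetaTerm p z k) * qBinom p N (k - 1) := by
    symm
    rw [thetaTrunc, ← tsum_mul_left, ← (Equiv.addRight (1 : ℤ)).tsum_eq]
    refine tsum_congr fun k => ?_
    simp only [Equiv.coe_addRight, add_sub_cancel_right]
    rw [thetaTerm_add_one hp hz, show (1 : ℤ) - (k + 1) = -k by ring, zpow_neg]
    have := zpow_ne_zero k hp
    field_simp
  have hdown : p / z * thetaTrunc p p z N
      = ∑' k : ℤ, -(p ^ (k + 1) * thetaTerm p z k) * qBinom p N (k + 1) := by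
    rw [thetaTrunc, ← tsum_mul_left, ← (Equiv.addRight (1 : ℤ)).tsum_eq]
    refine tsum_congr fun k => ?_
    simp only [Equiv.coe_addRight]
    rw [thetaTerm_add_one hp hz, zpow_add_one₀ hp]
    field_simp
  have s1 : Summable fun k : ℤ => -(p ^ (1 - k) * thetaTerm p z k) * qBinom p N (k - 1) := by
    have := summable_mul_qBinom p N fun k => -(p ^ (1 - (k + 1)) * thetaTerm p z (k + 1))
    rw [← (Equiv.addRight (1 : ℤ)).summable_iff]
    refine this.congr fun k => ?_
    simp
  have s2 : Summable fun k : ℤ => -(p ^ (k + 1) * thetaTerm p z k) * qBinom p N (k + 1) := by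
    have := summable_mul_qBinom p N fun k => -(p ^ k * thetaTerm p z (k - 1))
    rw [← (Equiv.addRight (-1 : ℤ)).summable_iff]
    refine this.congr fun k => ?_
    simp [sub_eq_add_neg]
  have s0 := summable_mul_qBinom p N fun k => (1 + p ^ (2 * N + 1)) * thetaTerm p z k
  have e : (1 - z * p ^ N) * (1 - p / z * p ^ N) * thetaTrunc p p z N
      = (1 + p ^ (2 * N + 1)) * thetaTrunc p p z N - p ^ N * (z * thetaTrunc p p z N)
        - p ^ N * (p / z * thetaTrunc p p z N) := by
    field_simp
    ring
  rw [e, hup, hdown, thetaTrunc, thetaTrunc, ← tsum_mul_left, ← tsum_mul_left, ← tsum_mul_left,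
    ← tsum_mul_left]
  simp only [← mul_assoc] at s0 ⊢
  simp only [mul_assoc] at s0 ⊢
  rw [← Summable.tsum_sub s0 (s1.mul_left _),
    ← Summable.tsum_sub (s0.sub (s1.mul_left _)) (s2.mul_left _)]
  refine tsum_congr fun k => ?_
  have hk : qBinom p N (k + 1)
      = (1 - p ^ ((N : ℤ) - k)) * (1 - p ^ ((N : ℤ) + 1 - k)) * qBinom p (N + 1) k := by
    have := qBinom_shift hp1 N (-k)
    rwa [show -k - 1 = -(k + 1) by ring, qBinom_neg, qBinom_neg, ← sub_eq_add_neg,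
      ← sub_eq_add_neg] at this
  rw [hk, qBinom_shift hp1, qBinom_pred hp1 N k]
  have hpk := zpow_ne_zero k hp
  simp only [zpow_add₀ hp, zpow_sub₀ hp, zpow_natCast, zpow_one, pow_mul', pow_succ]
  field_simp
  ring

lemma thetaTrunc_zero (q p z : ℂ) : thetaTrunc q p z 0 = 1 := by
  rw [thetaTrunc, tsum_eq_single 0]
  · simp [thetaTerm, tri, qBinom, qPochFin, qFacInv]
  · intro k hk
    rw [qBinom_eq_zero q (by simp; omega), mul_zero]

lemma finite_jacobi_triple {p z : ℂ} (hp : p ≠ 0) (hp1 : ‖p‖ < 1) (hz : z ≠ 0) (N : ℕ) :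
    qPochFin z p N * qPochFin (p / z) p N = qPochFin p p (2 * N) * thetaTrunc p p z N := by
  induction N with
  | zero => simp [qPochFin, thetaTrunc_zero]
  | succ N ih =>
    rw [qPochFin_succ, qPochFin_succ, show 2 * (N + 1) = 2 * N + 1 + 1 by ring, qPochFin_succ,
      qPochFin_succ]
    linear_combination (1 - z * p ^ N) * (1 - p / z * p ^ N) * ih
      + qPochFin p p (2 * N) * thetaTrunc_self_succ hp hp1 hz N

/-! ### The recursion in the truncation level -/

lemma thetaTrunc_three_term {q p : ℂ} (hq : q ≠ 0) (hq1 : ‖q‖ < 1) (N a : ℕ) :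
    (1 + (q ^ (N + 1)) ^ 2) * thetaTrunc q p (q ^ (a + 1)) (N + 1)
        - q ^ (N + 1) * thetaTrunc q p (q ^ a) (N + 1)
        - q ^ (N + 1) * thetaTrunc q p (q ^ (a + 2)) (N + 1)
      = thetaTrunc q p (q ^ (a + 1)) N := by
  simp only [thetaTrunc]
  have s := fun z => summable_mul_qBinom q (N + 1) (thetaTerm p z)
  rw [← tsum_mul_left, ← tsum_mul_left, ← tsum_mul_left,
    ← Summable.tsum_sub ((s _).mul_left _) ((s _).mul_left _),
    ← Summable.tsum_sub (((s _).mul_left _).sub ((s _).mul_left _)) ((s _).mul_left _)]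
  refine tsum_congr fun k => ?_
  rw [qBinom_pred hq1 N k]
  have hqk := zpow_ne_zero k hq
  simp only [thetaTerm, pow_succ, mul_zpow, zpow_add₀ hq, zpow_sub₀ hq, zpow_natCast, zpow_one]
  field_simp
  ring

lemma thetaTrunc_left_boundary {q p : ℂ} (hq1 : ‖q‖ < 1) (hq : q ≠ 0) (N : ℕ) :
    thetaTrunc q p 1 (N + 1) = q ^ (N + 1) * thetaTrunc q p q (N + 1) := by
  have s := fun z => summable_mul_qBinom q (N + 1) (thetaTerm p z)
  rw [← sub_eq_zero, thetaTrunc, thetaTrunc, ← tsum_mul_left,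
    ← Summable.tsum_sub (s _) ((s _).mul_left _), ← self_eq_neg, ← tsum_neg,
    ← (Equiv.subLeft (1 : ℤ)).tsum_eq]
  refine tsum_congr fun k => ?_
  have key : ∀ j : ℤ, thetaTerm p 1 j * qBinom q (N + 1) j
      - q ^ (N + 1) * (thetaTerm p q j * qBinom q (N + 1) j)
      = (-1) ^ j * p ^ tri j * (qFacInv q (N + j) * qFacInv q (N + (1 - j))) := by
    intro j
    have h1 := qFacInv_sub_one hq1 ((N : ℤ) + 1 + j)
    rw [show (N : ℤ) + 1 + j - 1 = N + j by ring, zpow_add₀ hq] at h1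
    rw [h1, thetaTerm, thetaTerm, one_zpow, qBinom, show (N : ℤ) + (1 - j) = N + 1 - j by ring]
    push_cast
    rw [← zpow_natCast q (N + 1)]
    push_cast
    ring
  rw [key, key, Equiv.subLeft_apply, tri_one_sub, sub_sub_cancel,
    zpow_sub₀ (neg_ne_zero.mpr one_ne_zero)]
  have : ((-1 : ℂ) ^ k)⁻¹ = (-1) ^ k := by rw [← inv_zpow, inv_neg, inv_one]
  rw [div_eq_mul_inv, this]
  ring

lemma thetaTrunc_right_boundary {q p : ℂ} (hq1 : ‖q‖ < 1) (hq : q ≠ 0) (hp : p ≠ 0) (N : ℕ) :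
    thetaTrunc q p p (N + 1) = q ^ (N + 1) * thetaTrunc q p (p / q) (N + 1) := by
  have h := thetaTrunc_left_boundary (p := p) hq1 hq N
  have refl : ∀ z : ℂ, z ≠ 0 → thetaTrunc q p (p / z) (N + 1) = thetaTrunc q p z (N + 1) := by
    intro z hz
    rw [thetaTrunc, ← (Equiv.neg ℤ).tsum_eq]
    refine tsum_congr fun k => ?_
    rw [Equiv.neg_apply, qBinom_neg, thetaTerm, thetaTerm, ← tri_one_sub, sub_neg_eq_add,
      add_comm, tri_add_one, zpow_add₀ hp, div_zpow, zpow_neg p, zpow_neg z, zpow_neg,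
      ← inv_zpow, inv_neg, inv_one]
    have := zpow_ne_zero k hp
    field_simp
  rw [← refl 1 one_ne_zero, ← refl q hq, div_one] at h
  exact h

/-- The kernel `x^{|u - v|}` inverts a tridiagonal difference operator with reflecting ends. -/
lemma sum_kernel_mul_three_term (x : ℂ) (P : ℕ → ℂ) (i j : ℕ) (h0 : P 0 = x * P 1)
    (h1 : P (i + j + 2) = x * P (i + j + 1)) :
    ∑ v ∈ Finset.range (i + j + 1), x ^ ((i : ℤ) - v).natAbs *
        ((1 + x ^ 2) * P (v + 1) - x * P v - x * P (v + 2)) = (1 - x ^ 2) * P (i + 1) := by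
  have hl : ∀ m, ∑ v ∈ Finset.range (m + 1), x ^ (m - v) *
      ((1 + x ^ 2) * P (v + 1) - x * P v - x * P (v + 2)) = P (m + 1) - x * P (m + 2) := by
    intro m
    induction m with
    | zero => simp [h0]; ring
    | succ m ih =>
      rw [Finset.sum_range_succ, Finset.sum_congr rfl (g := fun v => x * (x ^ (m - v) *
        ((1 + x ^ 2) * P (v + 1) - x * P v - x * P (v + 2)))), ← Finset.mul_sum, ih]
      · simp; ring
      · intro v hv
        rw [Nat.succ_sub (by simpa [Nat.lt_succ_iff] using hv), pow_succ]
        ring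
  have hr : ∀ m k, ∑ v ∈ Finset.range m, x ^ (v + 1) *
      ((1 + x ^ 2) * P (k + v + 1) - x * P (k + v) - x * P (k + v + 2))
        = x * (P (k + 1) - x * P k) - x ^ (m + 1) * (P (k + m + 1) - x * P (k + m)) := by
    intro m k
    induction m with
    | zero => simp
    | succ m ih =>
      rw [Finset.sum_range_succ, ih, ← add_assoc]
      ring
  rw [show i + j + 1 = i + 1 + j by ring, Finset.sum_range_add]
  have e1 : ∀ v ∈ Finset.range (i + 1), ((i : ℤ) - v).natAbs = i - v := by
    intro v hv
    have := Finset.mem_range.mp hv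
    omega
  have e2 : ∀ v, ((i : ℤ) - ((i + 1 + v : ℕ) : ℤ)).natAbs = v + 1 := by
    intro v
    omega
  rw [Finset.sum_congr rfl fun v hv => by rw [e1 v hv], hl]
  simp only [e2]
  rw [hr, show i + 1 + j + 1 = i + j + 2 by ring, h1, show i + 1 + j = i + j + 1 by ring]
  ring

/-! ### Passage to the limit -/

lemma summable_norm_mul_pow (a : ℂ) {q : ℂ} (hq : ‖q‖ < 1) :
    Summable fun k : ℕ => ‖-(a * q ^ k)‖ := by
  simp only [norm_neg, norm_mul, norm_pow]
  exact (summable_geometric_of_lt_one (norm_nonneg q) hq).mul_left _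

lemma tendsto_qPochFin (a : ℂ) {q : ℂ} (hq : ‖q‖ < 1) :
    Tendsto (qPochFin a q) atTop (𝓝 (qPoch a q)) := by
  have h := multipliable_one_add_of_summable (summable_norm_mul_pow a hq)
  simp only [← sub_eq_add_neg] at h
  exact h.hasProd.tendsto_prod_nat

lemma qPoch_self_ne_zero {q : ℂ} (hq : ‖q‖ < 1) : qPoch q q ≠ 0 := by
  have h := tprod_one_add_ne_zero_of_summable (f := fun k : ℕ => -(q * q ^ k))
    (fun k => by rw [← sub_eq_add_neg, ← pow_succ']; exact one_sub_pow_ne_zero hq k)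
    (summable_norm_mul_pow q hq)
  simp only [← sub_eq_add_neg] at h
  exact h

lemma tendsto_qFacInv_add {q : ℂ} (hq : ‖q‖ < 1) (k : ℤ) :
    Tendsto (fun N : ℕ => qFacInv q (N + k)) atTop (𝓝 (qPoch q q)⁻¹) := by
  have h := ((tendsto_qPochFin q hq).inv₀ (qPoch_self_ne_zero hq)).comp
    (tendsto_atTop_mono (f := fun N => N - k.natAbs) (g := fun N : ℕ => (N + k).toNat)
      (fun N => by omega) (tendsto_sub_atTop_nat _))
  refine h.congr' ?_
  filter_upwards [eventually_ge_atTop k.natAbs] with N hN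
  obtain ⟨m, hm⟩ : ∃ m : ℕ, (N : ℤ) + k = m := ⟨((N : ℤ) + k).toNat, by omega⟩
  simp [hm, qFacInv_natCast]

lemma exists_norm_qFacInv_le {q : ℂ} (hq : ‖q‖ < 1) : ∃ K, ∀ m, ‖qFacInv q m‖ ≤ K := by
  have h := (tendsto_qPochFin q hq).inv₀ (qPoch_self_ne_zero hq)
  obtain ⟨K, hK⟩ := h.norm.bddAbove_range
  have h_bound : ∀ m : ℕ, ‖(qPochFin q q m)⁻¹‖ ≤ K := fun m => hK ⟨m, rfl⟩
  refine ⟨K, fun m => ?_⟩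
  cases m with
  | ofNat m => exact h_bound m
  | negSucc m => simpa [qFacInv] using (norm_nonneg _).trans (h_bound 0)

lemma tendsto_thetaTrunc {q p z : ℂ} (hq : ‖q‖ < 1) (hs : Summable fun k => ‖thetaTerm p z k‖) :
    Tendsto (thetaTrunc q p z) atTop
      (𝓝 ((∑' k, thetaTerm p z k) * ((qPoch q q)⁻¹ * (qPoch q q)⁻¹))) := by
  obtain ⟨K, hK⟩ := exists_norm_qFacInv_le hq
  have hK0 : 0 ≤ K := (norm_nonneg _).trans (hK 0)
  rw [← tsum_mul_right]
  refine tendsto_tsum_of_dominated_convergence (hs.mul_right (K * K)) (fun k => ?_)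
    (Eventually.of_forall fun N k => ?_)
  · refine ((tendsto_qFacInv_add hq k).mul ?_).const_mul _
    simpa only [← sub_eq_add_neg] using tendsto_qFacInv_add hq (-k)
  · rw [norm_mul, qBinom, norm_mul]
    gcongr
    · exact hK _
    · exact hK _

/-- Jacobi's triple product identity. -/
lemma jacobi_triple {p z : ℂ} (hp : p ≠ 0) (hp1 : ‖p‖ < 1) (hz : z ≠ 0)
    (hs : Summable fun k => ‖thetaTerm p z k‖) :
    qPoch z p * qPoch (p / z) p * qPoch p p = ∑' k, thetaTerm p z k := by
  have h1 := (tendsto_qPochFin z hp1).mul (tendsto_qPochFin (p / z) hp1)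
  have h2 := ((tendsto_qPochFin p hp1).comp
    (tendsto_id.const_mul_atTop' two_pos)).mul (tendsto_thetaTrunc hp1 hs)
  have h := tendsto_nhds_unique (h1.congr fun N => finite_jacobi_triple hp hp1 hz N) h2
  rw [h]
  have := qPoch_self_ne_zero hp1
  field_simp

lemma summable_norm_thetaTerm {q : ℂ} (hq : q ≠ 0) (hq1 : ‖q‖ < 1) {n i : ℕ} (hi : i ≤ n) :
    Summable fun k => ‖thetaTerm (q ^ (n + 2)) (q ^ (i + 1)) k‖ := by
  have hgeom : Summable fun k : ℤ => ‖q‖ ^ k.natAbs := by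
    have h := summable_geometric_of_lt_one (norm_nonneg q) hq1
    exact Summable.of_nat_of_neg (by simpa using h) (by simpa using h)
  refine Summable.of_nonneg_of_le (fun _ => norm_nonneg _) (fun k => ?_) hgeom
  have e : ‖thetaTerm (q ^ (n + 2)) (q ^ (i + 1)) k‖
      = ‖q‖ ^ (((n : ℤ) + 2) * tri k + ((i : ℤ) + 1) * k) := by
    rw [zpow_add₀ (norm_ne_zero_iff.mpr hq), zpow_mul, zpow_mul, thetaTerm, norm_mul, norm_mul,
      norm_zpow, norm_zpow, norm_zpow, norm_neg, norm_one, one_zpow, one_mul, norm_pow, norm_pow]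
    norm_cast
  rw [e, ← zpow_natCast]
  refine zpow_le_zpow_right_of_le_one₀ (norm_pos_iff.mpr hq) hq1.le ?_
  have ht := two_mul_tri k
  have hin : (i : ℤ) ≤ n := by exact_mod_cast hi
  have hi0 : (0 : ℤ) ≤ i := Int.natCast_nonneg i
  rcases le_or_gt 0 k with hk | hk
  · have : 0 ≤ tri k := by
      rcases hk.eq_or_lt with rfl | hk
      · simp [tri]
      · nlinarith
    rw [Int.natAbs_of_nonneg hk]
    nlinarith [mul_nonneg hi0 hk]
  · rw [Int.ofNat_natAbs_of_nonpos hk.le]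
    have h1 : -k ≤ tri k := by nlinarith
    nlinarith

/-! ### The generating function of paths with a bounded number of steps -/

/-- The generating function of the coloured partitions that end in `(0, i)` and have `N` further
parts. -/
noncomputable def pathGF (q : ℂ) (n : ℕ) : ℕ → ℕ → ℂ
  | 0, _ => 1
  | N + 1, i => ∑ v ∈ Finset.range (n + 1),
      (q ^ (N + 1)) ^ ((i : ℤ) - v).natAbs * (1 - q ^ (N + 1))⁻¹ * pathGF q n N v

lemma pathGF_eq {q : ℂ} (hq : q ≠ 0) (hq1 : ‖q‖ < 1) (n N : ℕ) :
    ∀ i ≤ n, pathGF q n N i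
      = qPochFin (-q) q N * thetaTrunc q (q ^ (n + 2)) (q ^ (i + 1)) N := by
  induction N with
  | zero => simp [pathGF, qPochFin, thetaTrunc_zero]
  | succ N ih =>
    intro i hi
    obtain ⟨j, rfl⟩ := Nat.exists_eq_add_of_le hi
    have h := sum_kernel_mul_three_term (q ^ (N + 1))
      (fun a => thetaTrunc q (q ^ (i + j + 2)) (q ^ a) (N + 1)) i j
      (by simpa using thetaTrunc_left_boundary hq1 hq N)
      (by
        rw [thetaTrunc_right_boundary hq1 hq (pow_ne_zero _ hq), pow_succ q (i + j + 1),
          mul_div_cancel_right₀ _ hq])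
    simp only [thetaTrunc_three_term hq hq1] at h
    rw [pathGF, qPochFin_succ, Finset.sum_congr rfl (g := fun v : ℕ =>
      (1 - q ^ (N + 1))⁻¹ * qPochFin (-q) q N * ((q ^ (N + 1)) ^ ((i : ℤ) - v).natAbs *
        thetaTrunc q (q ^ (i + j + 2)) (q ^ (v + 1)) N)), ← Finset.mul_sum, h]
    · have := one_sub_pow_ne_zero hq1 N
      field_simp
      ring
    · intro v hv
      rw [ih v (by simpa [Nat.lt_succ_iff] using hv)]
      ring

lemma qPochFin_mul_three {q : ℂ} (N : ℕ) :
    qPochFin (-q) q N * qPochFin q q N * qPochFin q (q ^ 2) N = qPochFin q q (2 * N) := by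
  induction N with
  | zero => simp [qPochFin]
  | succ N ih =>
    rw [show 2 * (N + 1) = 2 * N + 1 + 1 by ring, qPochFin_succ, qPochFin_succ, qPochFin_succ,
      qPochFin_succ, qPochFin_succ, ← ih]
    ring

/-- Euler's identity `(-q; q)_∞ (q; q²)_∞ = 1`. -/
lemma qPoch_neg_mul {q : ℂ} (hq : ‖q‖ < 1) : qPoch (-q) q * qPoch q (q ^ 2) = 1 := by
  have hq2 : ‖q ^ 2‖ < 1 := by
    rw [norm_pow]
    exact pow_lt_one₀ (norm_nonneg q) hq two_ne_zero
  have h1 := ((tendsto_qPochFin (-q) hq).mul (tendsto_qPochFin q hq)).mul (tendsto_qPochFin q hq2)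
  have h2 := (tendsto_qPochFin q hq).comp (tendsto_id.const_mul_atTop' two_pos)
  have h := tendsto_nhds_unique (h1.congr qPochFin_mul_three) h2
  refine mul_right_cancel₀ (qPoch_self_ne_zero hq) ?_
  linear_combination h

lemma pathGF_zero_base {n i : ℕ} (hi : i ≤ n) (N : ℕ) : pathGF 0 n N i = 1 := by
  induction N generalizing i with
  | zero => rfl
  | succ N ih =>
    rw [pathGF, Finset.sum_eq_single i]
    · simp [ih hi]
    · intro v _ hv
      rw [zero_pow N.succ_ne_zero, zero_pow (by omega), zero_mul, zero_mul]
    · intro h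
      simp at h
      omega

lemma tendsto_pathGF {n i : ℕ} (hi : i ≤ n) {q : ℂ} (hq : ‖q‖ < 1) :
    Tendsto (fun N => pathGF q n N i) atTop
      (𝓝 (qPoch (q ^ (i + 1)) (q ^ (n + 2)) * qPoch (q ^ (n - i + 1)) (q ^ (n + 2)) *
        qPoch (q ^ (n + 2)) (q ^ (n + 2)) / (qPoch q (q ^ 2) * (qPoch q q) ^ 2))) := by
  rcases eq_or_ne q 0 with rfl | hq0
  · simp [pathGF_zero_base hi, qPoch]
  · have hp1 : ‖q ^ (n + 2)‖ < 1 := by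
      rw [norm_pow]
      exact pow_lt_one₀ (norm_nonneg q) hq (by omega)
    have hs := summable_norm_thetaTerm hq0 hq hi
    have hj := jacobi_triple (pow_ne_zero _ hq0) hp1 (pow_ne_zero _ hq0) hs
    have hdiv : q ^ (n + 2) / q ^ (i + 1) = q ^ (n - i + 1) := by
      rw [div_eq_iff (pow_ne_zero _ hq0), ← pow_add]
      congr 1
      omega
    rw [hdiv] at hj
    have h := ((tendsto_qPochFin (-q) hq).mul (tendsto_thetaTrunc hq hs)).congr fun N =>
      (pathGF_eq hq0 hq n N i hi).symm
    convert h using 2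
    rw [hj]
    have h1 := qPoch_neg_mul hq
    have h2 := qPoch_self_ne_zero hq
    have h3 : qPoch q (q ^ 2) ≠ 0 := right_ne_zero_of_mul_eq_one h1
    field_simp
    linear_combination -(∑' k, thetaTerm (q ^ (n + 2)) (q ^ (i + 1)) k) * h1

/-! ### Summation over coloured partitions, read from the last part upwards -/

/-- The difference condition between two consecutive parts, the smaller one first. -/
def Rises (x y : ℤ × ℕ) : Prop := |(y.2 : ℤ) - (x.2 : ℤ)| ≤ y.1 - x.1

/-- The lists of parts, in increasing order, that may be put on top of the part `p`. -/
def extensions (n : ℕ) (p : ℤ × ℕ) : Set (List (ℤ × ℕ)) :=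
  {R | (∀ r ∈ R, r.2 ≤ n) ∧ List.IsChain Rises (p :: R)}

/-- The sum of the parts. -/
def weight (R : List (ℤ × ℕ)) : ℕ := (R.map Prod.fst).sum.toNat

/-- The summand `q^{weight R}`, restricted to a set of coloured partitions. -/
noncomputable def term (q : ℂ) (S : Set (List (ℤ × ℕ))) : List (ℤ × ℕ) → ℂ :=
  S.indicator fun R => q ^ weight R

open Classical in
lemma term_apply (q : ℂ) (S : Set (List (ℤ × ℕ))) (R : List (ℤ × ℕ)) :
    term q S R = if R ∈ S then q ^ weight R else 0 := Set.indicator_apply ..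

lemma ofReal_norm_term (q : ℂ) (S : Set (List (ℤ × ℕ))) (R : List (ℤ × ℕ)) :
    ((‖term q S R‖ : ℝ) : ℂ) = term (‖q‖ : ℂ) S R := by
  by_cases h : R ∈ S <;> simp [term, h]

lemma nil_mem_extensions (n : ℕ) (p : ℤ × ℕ) : [] ∈ extensions n p := by
  simp [extensions]

lemma cons_mem_extensions {n : ℕ} {p r : ℤ × ℕ} {R : List (ℤ × ℕ)} :
    r :: R ∈ extensions n p ↔ r.2 ≤ n ∧ Rises p r ∧ R ∈ extensions n r := by
  simp only [extensions, Set.mem_ofPred_eq, List.mem_cons, forall_eq_or_imp,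
    List.isChain_cons_cons]
  tauto

lemma Rises.fst_nonneg {p r : ℤ × ℕ} (h : Rises p r) (hp : 0 ≤ p.1) : 0 ≤ r.1 := by
  have := (abs_nonneg _).trans h
  omega

lemma sum_nonneg_of_mem_extensions {n : ℕ} {p : ℤ × ℕ} {R : List (ℤ × ℕ)} (hp : 0 ≤ p.1)
    (h : R ∈ extensions n p) : 0 ≤ (R.map Prod.fst).sum := by
  induction R generalizing p with
  | nil => simp
  | cons r R ih =>
    obtain ⟨-, h1, h2⟩ := cons_mem_extensions.mp h
    have h3 := h1.fst_nonneg hp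
    have h4 := ih h3 h2
    simp only [List.map_cons, List.sum_cons]
    omega

lemma weight_cons {n : ℕ} {r : ℤ × ℕ} {R : List (ℤ × ℕ)} (hr : 0 ≤ r.1)
    (h : R ∈ extensions n r) : weight (r :: R) = r.1.toNat + weight R := by
  rw [weight, weight, List.map_cons, List.sum_cons,
    Int.toNat_add hr (sum_nonneg_of_mem_extensions hr h)]

lemma hasSum_prod_of_norm {α β : Type*} {F : α × β → ℂ} {g g' : α → ℂ} {a : ℂ}
    (hF : ∀ x, HasSum (fun y => F (x, y)) (g x))
    (hF' : ∀ x, HasSum (fun y => ((‖F (x, y)‖ : ℝ) : ℂ)) (g' x)) (hg' : Summable g')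
    (hg : HasSum g a) : HasSum F a := by
  have hs : Summable F := by
    refine Summable.of_norm ((summable_prod_of_nonneg fun _ => norm_nonneg _).mpr
      ⟨fun x => Complex.summable_ofReal.mp (hF' x).summable, Complex.summable_ofReal.mp ?_⟩)
    refine hg'.congr fun x => ?_
    rw [Complex.ofReal_tsum]
    exact (hF' x).tsum_eq.symm
  rw [← (hs.hasSum.prod_fiberwise hF).unique hg]
  exact hs.hasSum

/-- The coloured partitions with exactly `N` parts on top of the part `p`. -/
def extensionsOfLength (n N : ℕ) (p : ℤ × ℕ) : Set (List (ℤ × ℕ)) :=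
  {R | R.length = N ∧ R ∈ extensions n p}

lemma hasSum_mul_geometric {n : ℕ} (A : Fin (n + 1) → ℂ) {x : ℂ} (hx : ‖x‖ < 1) :
    HasSum (fun y : Fin (n + 1) × ℕ => A y.1 * x ^ y.2) ((∑ v, A v) * (1 - x)⁻¹) := by
  refine (hasSum_fintype A).mul (hasSum_geometric_of_norm_lt_one hx)
    (summable_mul_of_summable_norm (hasSum_fintype _).summable ?_)
  simpa only [norm_pow] using summable_geometric_of_lt_one (norm_nonneg x) hx

/-- Adding the next part, of colour `v`, to a part `c` of colour `i`; it exceeds by `d` the least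
possible value. -/
def addPart (n c i : ℕ) (x : (Fin (n + 1) × ℕ) × List (ℤ × ℕ)) : List (ℤ × ℕ) :=
  (((c + ((i : ℤ) - (x.1.1 : ℕ)).natAbs + x.1.2 : ℕ) : ℤ), (x.1.1 : ℕ)) :: x.2

lemma addPart_injective (n c i : ℕ) : Function.Injective (addPart n c i) := by
  rintro ⟨⟨v, d⟩, t⟩ ⟨⟨v', d'⟩, t'⟩ h
  simp only [addPart, List.cons.injEq, Prod.mk.injEq] at h
  obtain ⟨⟨h1, h2⟩, rfl⟩ := h
  obtain rfl := Fin.ext h2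
  obtain rfl : d = d' := by omega
  rfl

lemma term_addPart (q : ℂ) (n N c i : ℕ) (x : (Fin (n + 1) × ℕ) × List (ℤ × ℕ)) :
    term q (extensionsOfLength n (N + 1) (c, i)) (addPart n c i x)
      = q ^ (c + ((i : ℤ) - (x.1.1 : ℕ)).natAbs + x.1.2) *
        term q (extensionsOfLength n N
          (((c + ((i : ℤ) - (x.1.1 : ℕ)).natAbs + x.1.2 : ℕ) : ℤ), (x.1.1 : ℕ))) x.2 := by
  obtain ⟨⟨v, d⟩, t⟩ := x
  simp only [addPart]
  set e := c + ((i : ℤ) - (v : ℕ)).natAbs + d with he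
  have hr : Rises ((c : ℤ), i) ((e : ℤ), (v : ℕ)) := by
    simp only [Rises, abs_sub_comm ((v : ℕ) : ℤ), Int.abs_eq_natAbs]
    omega
  by_cases h : t ∈ extensionsOfLength n N ((e : ℤ), (v : ℕ))
  · have h' : ((e : ℤ), (v : ℕ)) :: t ∈ extensionsOfLength n (N + 1) (c, i) :=
      ⟨by simp [h.1], cons_mem_extensions.mpr ⟨Nat.lt_succ_iff.mp v.2, hr, h.2⟩⟩
    rw [term, term, Set.indicator_of_mem h, Set.indicator_of_mem h',
      weight_cons (Int.natCast_nonneg e) h.2, pow_add]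
    simp
  · have h' : ((e : ℤ), (v : ℕ)) :: t ∉ extensionsOfLength n (N + 1) (c, i) := fun h' =>
      h ⟨by simpa using h'.1, (cons_mem_extensions.mp h'.2).2.2⟩
    rw [term, term, Set.indicator_of_notMem h, Set.indicator_of_notMem h', mul_zero]

lemma term_eq_zero_of_notMem_range (q : ℂ) (n N c i : ℕ) (R : List (ℤ × ℕ))
    (hR : R ∉ Set.range (addPart n c i)) :
    term q (extensionsOfLength n (N + 1) (c, i)) R = 0 := by
  refine Set.indicator_of_notMem (fun h => hR ?_) _
  obtain ⟨h1, h2⟩ := h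
  cases R with
  | nil => simp at h1
  | cons r t =>
    obtain ⟨h3, h4, -⟩ := cons_mem_extensions.mp h2
    obtain ⟨e, v⟩ := r
    simp only [Rises, abs_sub_comm (v : ℤ), Int.abs_eq_natAbs] at h3 h4
    refine ⟨((⟨v, Nat.lt_succ_of_le h3⟩, (e - c - ((i : ℤ) - v).natAbs).toNat), t), ?_⟩
    simp only [addPart, List.cons.injEq, Prod.mk.injEq, and_true]
    omega

lemma hasSum_term_extensionsOfLength (n N : ℕ) {q : ℂ} (hq : ‖q‖ < 1) (c i : ℕ) :
    HasSum (term q (extensionsOfLength n N (c, i))) ((q ^ c) ^ N * pathGF q n N i) := by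
  induction N generalizing q c i with
  | zero =>
    have h := hasSum_single (f := term q (extensionsOfLength n 0 (c, i))) [] fun R hR =>
      Set.indicator_of_notMem (fun h => hR (List.length_eq_zero_iff.mp h.1)) _
    rwa [term, Set.indicator_of_mem (show [] ∈ extensionsOfLength n 0 (c, i) from
      ⟨rfl, nil_mem_extensions n _⟩), ← term, show q ^ weight [] = (q ^ c) ^ 0 * pathGF q n 0 i by
        simp [weight, pathGF]] at h
  | succ N ih =>
    have hgeom : ∀ {q : ℂ}, ‖q‖ < 1 → HasSum (fun x : Fin (n + 1) × ℕ =>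
        q ^ (c + ((i : ℤ) - (x.1 : ℕ)).natAbs + x.2) *
          ((q ^ (c + ((i : ℤ) - (x.1 : ℕ)).natAbs + x.2)) ^ N * pathGF q n N x.1))
        ((q ^ c) ^ (N + 1) * pathGF q n (N + 1) i) := by
      intro q hq
      have hx : ‖q ^ (N + 1)‖ < 1 := by
        rw [norm_pow]
        exact pow_lt_one₀ (norm_nonneg q) hq N.succ_ne_zero
      have h := hasSum_mul_geometric (n := n) (fun v => (q ^ c) ^ (N + 1) *
        ((q ^ (N + 1)) ^ ((i : ℤ) - (v : ℕ)).natAbs * pathGF q n N v)) hx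
      convert h using 1
      · funext x
        ring
      · rw [pathGF, Finset.sum_range, Finset.mul_sum, Finset.sum_mul]
        exact Finset.sum_congr rfl fun v _ => by ring
    have hq' : ‖((‖q‖ : ℝ) : ℂ)‖ < 1 := by simpa using hq
    rw [← (addPart_injective n c i).hasSum_iff
      (term_eq_zero_of_notMem_range q n N c i)]
    refine hasSum_prod_of_norm (fun x => ?_) (fun x => ?_) (hgeom hq').summable (hgeom hq)
    · simp only [Function.comp_apply, term_addPart]
      exact (ih hq _ _).mul_left _
    · simp only [Function.comp_apply, term_addPart, norm_mul, Complex.ofReal_mul,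
        ofReal_norm_term, norm_pow, Complex.ofReal_pow]
      exact (ih hq' _ _).mul_left _

/-- The coloured partitions on top of the part `(0, i)` whose first part differs from `(0, i)`. -/
def grounded (n i : ℕ) : Set (List (ℤ × ℕ)) :=
  {R | R ∈ extensions n (0, i) ∧ R.head? ≠ some (0, i)}

/-- The members of `grounded n i` with at most `N` parts. -/
def groundedUpTo (n i N : ℕ) : Set (List (ℤ × ℕ)) := {R | R.length ≤ N ∧ R ∈ grounded n i}

lemma term_groundedUpTo_succ {n i : ℕ} (hi : i ≤ n) (q : ℂ) (N : ℕ) (R : List (ℤ × ℕ)) :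
    term q (groundedUpTo n i (N + 1)) R = term q (groundedUpTo n i N) R +
      term q (extensionsOfLength n (N + 1) (0, i)) R -
      (if R.head? = some (0, i) then term q (extensionsOfLength n N (0, i)) R.tail else 0) := by
  cases R with
  | nil => simp [term, groundedUpTo, grounded, extensionsOfLength, nil_mem_extensions]
  | cons r t =>
    by_cases hr : r = (0, i)
    · subst hr
      have hz : Rises ((0 : ℤ), i) (0, i) := by simp [Rises]
      have hw : weight (((0 : ℤ), i) :: t) = weight t := by simp [weight]
      have hg : ∀ M, ((0 : ℤ), i) :: t ∉ groundedUpTo n i M := fun M h => h.2.2 rfl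
      have hm : ((0 : ℤ), i) :: t ∈ extensionsOfLength n (N + 1) (0, i) ↔
          t ∈ extensionsOfLength n N (0, i) := by
        simp [extensionsOfLength, cons_mem_extensions, hi, hz]
      by_cases ht : t ∈ extensionsOfLength n N (0, i)
      · simp [term_apply, hg, hm.mpr ht, ht, hw]
      · simp [term_apply, hg, mt hm.mp ht, ht]
    · simp only [term_apply, groundedUpTo, grounded, extensionsOfLength,
        Set.mem_ofPred_eq, List.head?_cons, Option.some.injEq, hr, List.length_cons, if_false,
        ne_eq, not_false_eq_true, and_true, sub_zero]
      by_cases ht : r :: t ∈ extensions n (0, i)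
      · rcases lt_trichotomy t.length N with h | h | h
        · simp [ht, h.le, h.ne, h]
        · simp [ht, h, hr]
        · simp [ht, h.ne', h.not_ge, not_le.mpr (Nat.lt_succ_of_lt h)]
      · simp [ht]

lemma hasSum_term_groundedUpTo {n i : ℕ} (hi : i ≤ n) {q : ℂ} (hq : ‖q‖ < 1) (N : ℕ) :
    HasSum (term q (groundedUpTo n i N)) (pathGF q n N i) := by
  induction N with
  | zero =>
    have h := hasSum_single (f := term q (groundedUpTo n i 0)) [] fun R hR =>
      Set.indicator_of_notMem
        (fun h => hR (List.length_eq_zero_iff.mp (Nat.le_zero.mp h.1))) _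
    convert h using 1
    simp [term, groundedUpTo, grounded, nil_mem_extensions, weight, pathGF]
  | succ N ih =>
    have h1 := hasSum_term_extensionsOfLength n (N + 1) hq 0 i
    have h2 : HasSum (fun R : List (ℤ × ℕ) => if R.head? = some ((0 : ℤ), i) then
        term q (extensionsOfLength n N (0, i)) R.tail else 0) (pathGF q n N i) := by
      rw [← (List.cons_injective (a := ((0 : ℤ), i))).hasSum_iff]
      · simpa [Function.comp_def] using hasSum_term_extensionsOfLength n N hq 0 i
      · intro R hR
        refine if_neg fun h => hR ?_
        obtain ⟨t, rfl⟩ := List.head?_eq_some_iff.mp h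
        exact ⟨t, rfl⟩
    have h := (ih.add h1).sub h2
    simp only [pow_zero, one_pow, one_mul, Nat.cast_zero, add_sub_cancel_left] at h
    exact h.congr_fun fun R => term_groundedUpTo_succ hi q N R

lemma term_groundedUpTo_of_length_le (q : ℂ) (n i : ℕ) {N : ℕ} {R : List (ℤ × ℕ)}
    (h : R.length ≤ N) : term q (groundedUpTo n i N) R = term q (grounded n i) R := by
  simp only [term_apply, groundedUpTo, Set.mem_ofPred_eq]
  split_ifs <;> simp_all

lemma summable_norm_term_grounded {n i : ℕ} (hi : i ≤ n) {q : ℂ} (hq : ‖q‖ < 1) :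
    Summable fun R => ‖term q (grounded n i) R‖ := by
  have hq' : ‖((‖q‖ : ℝ) : ℂ)‖ < 1 := by simpa using hq
  obtain ⟨K, hK⟩ := (tendsto_pathGF hi hq').norm.bddAbove_range
  refine summable_of_sum_le (c := K) (fun _ => norm_nonneg _) fun s => ?_
  set N := s.sup List.length
  have h := hasSum_term_groundedUpTo hi hq' N
  rw [← funext (ofReal_norm_term q (groundedUpTo n i N))] at h
  have hs := Complex.summable_ofReal.mp h.summable
  calc ∑ R ∈ s, ‖term q (grounded n i) R‖ = ∑ R ∈ s, ‖term q (groundedUpTo n i N) R‖ :=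
        Finset.sum_congr rfl fun R hR => by
          rw [term_groundedUpTo_of_length_le q n i (Finset.le_sup (f := List.length) hR)]
    _ ≤ ∑' R, ‖term q (groundedUpTo n i N) R‖ := hs.sum_le_tsum s fun _ _ => norm_nonneg _
    _ ≤ ‖pathGF (‖q‖ : ℂ) n N i‖ := by
        rw [← h.tsum_eq, ← Complex.ofReal_tsum, Complex.norm_real]
        exact le_abs_self _
    _ ≤ K := hK ⟨N, rfl⟩

lemma tsum_term_grounded {n i : ℕ} (hi : i ≤ n) {q : ℂ} (hq : ‖q‖ < 1) :
    ∑' R, term q (grounded n i) R =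
      qPoch (q ^ (i + 1)) (q ^ (n + 2)) * qPoch (q ^ (n - i + 1)) (q ^ (n + 2)) *
        qPoch (q ^ (n + 2)) (q ^ (n + 2)) / (qPoch q (q ^ 2) * (qPoch q q) ^ 2) := by
  refine tendsto_nhds_unique (tendsto_tsum_of_dominated_convergence
    (f := fun N => term q (groundedUpTo n i N)) (𝓕 := atTop)
    (summable_norm_term_grounded hi hq) (fun R => ?_) (Eventually.of_forall fun N R => ?_)) ?_
  · refine tendsto_const_nhds.congr' ?_
    filter_upwards [eventually_ge_atTop R.length] with N hN
    rw [term_groundedUpTo_of_length_le q n i hN]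
  · by_cases h : R.length ≤ N
    · rw [term_groundedUpTo_of_length_le q n i h]
    · simp [term, groundedUpTo, h]
  · simpa only [(hasSum_term_groundedUpTo hi hq _).tsum_eq] using tendsto_pathGF hi hq

lemma CgeSet_eq_image {n i : ℕ} (hi : i ≤ n) (m : ℕ) :
    CgeSet n i m = (fun R => (((0 : ℤ), i) :: R).reverse) '' (weight ⁻¹' {m} ∩ grounded n i) := by
  ext L
  obtain ⟨M, rfl⟩ := List.reverse_surjective L
  have hflip : (fun a b : ℤ × ℕ => b.1 - a.1 ≥ |(b.2 : ℤ) - (a.2 : ℤ)|) = Rises := rfl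
  have hchain : List.IsChain (fun x y : ℤ × ℕ => x.1 - y.1 ≥ |(x.2 : ℤ) - (y.2 : ℤ)|) M.reverse
      ↔ List.IsChain Rises M := by
    rw [List.isChain_reverse, ← hflip]
  have hset : M.reverse ∈ CgeSet n i m ↔ (∀ p ∈ M, p.2 ≤ n) ∧ List.IsChain Rises M ∧
      M.head? = some (0, i) ∧ (∀ p ∈ M[1]?, p ≠ ((0 : ℤ), i)) ∧
      (M.map Prod.fst).sum = (m : ℤ) := by
    rw [← hchain]
    simp only [CgeSet, Set.mem_ofPred_eq, List.mem_reverse, List.getLast?_reverse,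
      List.reverse_reverse, List.map_reverse, List.sum_reverse]
    rfl
  rw [hset]
  simp only [Set.mem_image, List.reverse_inj]
  constructor
  · rintro ⟨h1, h2, h3, h4, h5⟩
    obtain ⟨R, rfl⟩ := List.head?_eq_some_iff.mp h3
    refine ⟨R, ⟨?_, ⟨fun r hr => h1 r (List.mem_cons_of_mem _ hr), h2⟩, ?_⟩, rfl⟩
    · simp only [List.map_cons, List.sum_cons, zero_add] at h5
      simp [weight, h5]
    · intro h
      exact h4 (0, i) (by simpa [List.head?_eq_getElem?] using h) rfl
  · rintro ⟨R, ⟨hw, hR, hh⟩, rfl⟩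
    refine ⟨?_, hR.2, rfl, ?_, ?_⟩
    · simpa [hi] using hR.1
    · rintro p hp rfl
      exact hh (by simpa [List.head?_eq_getElem?] using hp)
    · have h0 := sum_nonneg_of_mem_extensions le_rfl hR
      have hw' : (R.map Prod.fst).sum.toNat = m := hw
      simp only [List.map_cons, List.sum_cons, zero_add]
      omega

lemma tsum_fiber_term_grounded {n i : ℕ} (hi : i ≤ n) (q : ℂ) (m : ℕ) :
    ∑' R : weight ⁻¹' {m}, term q (grounded n i) R = (Cge n i m : ℂ) * q ^ m := by
  have hinj : Function.Injective fun R : List (ℤ × ℕ) => (((0 : ℤ), i) :: R).reverse :=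
    fun R R' h => by simpa using h
  rw [Cge, CgeSet_eq_image hi, Set.ncard_image_of_injective _ hinj, tsum_subtype, term,
    Set.indicator_indicator, Set.indicator_congr (g := fun _ => q ^ m), ← tsum_subtype, tsum_const,
    Nat.card_coe_set_eq, nsmul_eq_mul]
  intro R hR
  exact congrArg (q ^ ·) hR.1

end AGCompanion

/-- Theorem 1.7, equation (1.7): for `0 ≤ i ≤ n`,
`∑_{m≥0} C^≥_{i,n}(m) qᵐ = (q^{i+1}, q^{n−i+1}, q^{n+2}; q^{n+2})_∞ / ((q;q²)_∞ (q;q)²_∞)`. -/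
theorem agCompanionGe (n i : ℕ) (hi : i ≤ n) (q : ℂ) (hq : ‖q‖ < 1) :
    ∑' m : ℕ, (Cge n i m : ℂ) * q ^ m =
      qPoch (q ^ (i + 1)) (q ^ (n + 2)) * qPoch (q ^ (n - i + 1)) (q ^ (n + 2)) *
        qPoch (q ^ (n + 2)) (q ^ (n + 2)) /
      (qPoch q (q ^ 2) * (qPoch q q) ^ 2) := by
  rw [← AGCompanion.tsum_term_grounded hi hq]
  have h := (AGCompanion.summable_norm_term_grounded hi hq).of_norm.hasSum.tsum_fiberwise
    AGCompanion.weight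
  simp only [AGCompanion.tsum_fiber_term_grounded hi] at h
  exact h.tsum_eq
end

section
/- For all integers n ≥ 0, 0 ≤ i ≤ n and m ≥ 0, one has C^≥_{i,n}(m) = ∑_{t=0}^{m} C_{i,n}(m−t) · p(t), where p(t) denotes the number of ordinary (unrestricted) partitions of t, with p(0) = 1. (Equivalently, there is a weight-preserving bijection between the set counted by C^≥_{i,n} and the Cartesian product of the set counted by C_{i,n} with the set of ordinary partitions.) -/
open scoped BigOperators

/-- `M` together with a final part `(0, i)`: consecutive parts are related by `R`, colours are at
most `n`, and the last part of `M` (if any) satisfies `Q`. -/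
def ColouredChain (n i : ℕ) (R : ℤ × ℕ → ℤ × ℕ → Prop) (Q : ℤ × ℕ → Prop) : List (ℤ × ℕ) → Prop
  | [] => True
  | p :: M => p.2 ≤ n ∧ R p (M.headD (0, i)) ∧ (M = [] → Q p) ∧ ColouredChain n i R Q M

/-- The parts other than the final `(0, i)` of the elements of `CeqSet n i m`, for all `m`. -/
abbrev FlatChain (n i : ℕ) : List (ℤ × ℕ) → Prop :=
  ColouredChain n i (fun x y => x.1 - y.1 = |(x.2 : ℤ) - (y.2 : ℤ)|) (fun p => p.2 ≠ i)

/-- The parts other than the final `(0, i)` of the elements of `CgeSet n i m`, for all `m`. -/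
abbrev GapChain (n i : ℕ) : List (ℤ × ℕ) → Prop :=
  ColouredChain n i (fun x y => x.1 - y.1 ≥ |(x.2 : ℤ) - (y.2 : ℤ)|) (fun p => p ≠ (0, i))

theorem colouredChain_iff (n i : ℕ) (hi : i ≤ n) (R : ℤ × ℕ → ℤ × ℕ → Prop) (Q : ℤ × ℕ → Prop)
    (M : List (ℤ × ℕ)) :
    ColouredChain n i R Q M ↔ (∀ p ∈ M ++ [(0, i)], p.2 ≤ n) ∧
      List.IsChain R (M ++ [(0, i)]) ∧ ∀ p ∈ (M ++ [(0, i)]).reverse[1]?, Q p := by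
  have key : ∀ M : List (ℤ × ℕ), (M ++ [((0 : ℤ), i)]).reverse[1]? = M.getLast? := by
    intro M
    simp [List.getLast?_eq_head?_reverse, List.head?_eq_getElem?]
  rw [key]
  induction M with
  | nil => simp [ColouredChain, hi]
  | cons p M ih =>
    simp only [ColouredChain, ih]
    cases M with
    | nil => simp [hi]
    | cons q M =>
      simp only [List.cons_append, List.isChain_cons_cons, List.mem_cons, List.headD_cons,
        List.getLast?_cons_cons, forall_eq_or_imp, reduceCtorEq, false_imp_iff, true_and]
      tauto

theorem ncard_colouredChain (n i m : ℕ) (hi : i ≤ n) (R : ℤ × ℕ → ℤ × ℕ → Prop)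
    (Q : ℤ × ℕ → Prop) :
    {L : List (ℤ × ℕ) | (∀ p ∈ L, p.2 ≤ n) ∧ List.IsChain R L ∧ L.getLast? = some (0, i) ∧
      (∀ p ∈ L.reverse[1]?, Q p) ∧ (L.map Prod.fst).sum = (m : ℤ)}.ncard =
    Nat.card {M : List (ℤ × ℕ) // ColouredChain n i R Q M ∧ (M.map Prod.fst).sum = (m : ℤ)} := by
  have h : {L : List (ℤ × ℕ) | (∀ p ∈ L, p.2 ≤ n) ∧ List.IsChain R L ∧
      L.getLast? = some (0, i) ∧ (∀ p ∈ L.reverse[1]?, Q p) ∧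
      (L.map Prod.fst).sum = (m : ℤ)} =
      (fun M => M ++ [((0 : ℤ), i)]) ''
        {M | ColouredChain n i R Q M ∧ (M.map Prod.fst).sum = (m : ℤ)} := by
    ext L
    simp only [Set.mem_ofPred_eq, Set.mem_image]
    constructor
    · rintro ⟨h1, h2, h3, h4, h5⟩
      obtain ⟨M, rfl⟩ := List.getLast?_eq_some_iff.1 h3
      exact ⟨M, ⟨(colouredChain_iff n i hi R Q M).2 ⟨h1, h2, h4⟩, by simpa using h5⟩, rfl⟩
    · rintro ⟨M, ⟨h, h5⟩, rfl⟩
      obtain ⟨h1, h2, h4⟩ := (colouredChain_iff n i hi R Q M).1 h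
      exact ⟨h1, h2, by simp, h4, by simpa using h5⟩
  rw [h, Set.ncard_image_of_injective _ (List.append_left_injective _)]
  rfl

theorem Cge_eq_card (n i m : ℕ) (hi : i ≤ n) :
    Cge n i m =
      Nat.card {M : List (ℤ × ℕ) // GapChain n i M ∧ (M.map Prod.fst).sum = (m : ℤ)} :=
  ncard_colouredChain n i m hi _ _

theorem Ceq_eq_card_s2 (n i m : ℕ) (hi : i ≤ n) :
    Ceq n i m =
      Nat.card {M : List (ℤ × ℕ) // FlatChain n i M ∧ (M.map Prod.fst).sum = (m : ℤ)} :=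
  ncard_colouredChain n i m hi _ _

theorem FlatChain.one_le_head {n i : ℕ} {p : ℤ × ℕ} {M : List (ℤ × ℕ)}
    (h : FlatChain n i (p :: M)) : 1 ≤ p.1 := by
  induction M generalizing p with
  | nil =>
    obtain ⟨-, h1, h2, -⟩ := h
    have h3 : 0 < |(p.2 : ℤ) - (i : ℤ)| := abs_pos.2 (by have := h2 rfl; omega)
    simp only [List.headD_nil] at h1
    omega
  | cons q M ih =>
    obtain ⟨-, h1, -, h3⟩ := h
    have := ih h3
    have := abs_nonneg ((p.2 : ℤ) - (q.2 : ℤ))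
    simp only [List.headD_cons] at h1
    omega

theorem FlatChain.bounds {n i : ℕ} {M : List (ℤ × ℕ)} (h : FlatChain n i M) :
    (M.length : ℤ) ≤ (M.map Prod.fst).sum ∧
      ∀ p ∈ M, 0 ≤ p.1 ∧ p.1 ≤ (M.map Prod.fst).sum ∧ p.2 ≤ n := by
  induction M with
  | nil => simp
  | cons p M ih =>
    have h1 := h.one_le_head
    obtain ⟨h2, -, -, h3⟩ := h
    obtain ⟨h4, h5⟩ := ih h3
    simp only [List.length_cons, List.map_cons, List.sum_cons, List.mem_cons, forall_eq_or_imp]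
    refine ⟨by push_cast; omega, ⟨by omega, by omega, h2⟩, fun q hq => ?_⟩
    have := h5 q hq
    omega

theorem finite_flatChain (n i m : ℕ) :
    Finite {M : List (ℤ × ℕ) // FlatChain n i M ∧ (M.map Prod.fst).sum = (m : ℤ)} := by
  let s : Set (ℤ × ℕ) := Set.Icc 0 (m : ℤ) ×ˢ Set.Iic n
  have hs : Finite s := ((Set.finite_Icc _ _).prod (Set.finite_Iic _)).to_subtype
  refine (((List.finite_length_le s m).image (List.map Subtype.val)).subset ?_).to_subtype
  rintro M ⟨h, hm⟩
  obtain ⟨h1, h2⟩ := h.bounds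
  rw [hm] at h1 h2
  have hM : M ∈ Set.range (List.map (Subtype.val : s → ℤ × ℕ)) := by
    rw [Set.range_list_map_coe]
    exact fun p hp => ⟨⟨(h2 p hp).1, (h2 p hp).2.1⟩, (h2 p hp).2.2⟩
  obtain ⟨l, rfl⟩ := hM
  exact ⟨l, by simpa using h1, rfl⟩

/-- Add the parts of `ν` to those of `μ`, padding `μ` with parts `(0, i)` where `ν` is longer. -/
def augment (i : ℕ) : List (ℤ × ℕ) → List ℕ → List (ℤ × ℕ)
  | [], [] => []
  | [], x :: ν => ((x : ℤ), i) :: augment i [] ν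
  | p :: μ, [] => p :: augment i μ []
  | p :: μ, x :: ν => (p.1 + x, p.2) :: augment i μ ν

theorem headD_augment (i : ℕ) (μ : List (ℤ × ℕ)) (ν : List ℕ) :
    (augment i μ ν).headD (0, i) =
      ((μ.headD (0, i)).1 + (ν.headD 0 : ℕ), (μ.headD (0, i)).2) := by
  cases μ <;> cases ν <;> simp [augment]

theorem sum_augment (i : ℕ) (μ : List (ℤ × ℕ)) (ν : List ℕ) :
    ((augment i μ ν).map Prod.fst).sum = (μ.map Prod.fst).sum + (ν.sum : ℕ) := by
  induction μ, ν using augment.induct <;> (simp_all [augment]; try ring)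

theorem augment_eq_nil {i : ℕ} {μ : List (ℤ × ℕ)} {ν : List ℕ} :
    augment i μ ν = [] ↔ μ = [] ∧ ν = [] := by
  cases μ <;> cases ν <;> simp [augment]

/-- Weakly decreasing lists of positive integers. -/
def IsPartitionList (ν : List ℕ) : Prop := ν.Pairwise (· ≥ ·) ∧ ∀ x ∈ ν, 0 < x

theorem isPartitionList_cons {x : ℕ} {ν : List ℕ} :
    IsPartitionList (x :: ν) ↔ ν.headD 0 ≤ x ∧ 0 < x ∧ IsPartitionList ν := by
  cases ν with
  | nil => simp [IsPartitionList]
  | cons y ν =>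
    simp only [IsPartitionList, List.pairwise_cons, List.mem_cons, forall_eq_or_imp,
      List.headD_cons]
    constructor
    · tauto
    · rintro ⟨h1, h2, ⟨h3, h4⟩, h5⟩
      exact ⟨⟨⟨h1, fun a ha => (h3 a ha).trans h1⟩, h3, h4⟩, h2, h5⟩

theorem IsPartitionList.eq_nil {ν : List ℕ} (h : IsPartitionList ν) (h0 : ν.headD 0 = 0) :
    ν = [] := by
  cases ν with
  | nil => rfl
  | cons x ν => have := h.2 x (by simp); simp at h0; omega

theorem gapChain_augment {n i : ℕ} (hi : i ≤ n) {μ : List (ℤ × ℕ)} {ν : List ℕ}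
    (hμ : FlatChain n i μ) (hν : IsPartitionList ν) : GapChain n i (augment i μ ν) := by
  induction μ, ν using augment.induct with
  | case1 => simp [augment, ColouredChain]
  | case2 x ν ih =>
    obtain ⟨h1, h2, h3⟩ := isPartitionList_cons.1 hν
    rw [augment]
    refine ⟨hi, ?_, fun _ h => ?_, ih hμ h3⟩
    · rw [headD_augment]
      simp only [List.headD_nil, sub_self, abs_zero]
      omega
    · simp only [Prod.mk.injEq] at h
      omega
  | case3 p μ ih =>
    obtain ⟨h1, h2, h3, h4⟩ := hμ
    rw [augment]
    refine ⟨h1, ?_, fun h h' => h3 (augment_eq_nil.1 h).1 (by rw [h']), ih h4 hν⟩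
    rw [headD_augment]
    simpa using h2.ge
  | case4 p μ x ν ih =>
    obtain ⟨h1, h2, h3, h4⟩ := hμ
    obtain ⟨h5, h6, h7⟩ := isPartitionList_cons.1 hν
    rw [augment]
    refine ⟨h1, ?_, fun h h' => h3 (augment_eq_nil.1 h).1 (Prod.mk.inj h').2, ih h4 h7⟩
    rw [headD_augment]
    dsimp only at h2 ⊢
    omega

theorem exists_augment_eq {n i : ℕ} {M : List (ℤ × ℕ)} (hM : GapChain n i M) :
    ∃ μ ν, FlatChain n i μ ∧ IsPartitionList ν ∧ augment i μ ν = M := by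
  induction M with
  | nil => exact ⟨[], [], trivial, ⟨.nil, by simp⟩, by rw [augment]⟩
  | cons p M ih =>
    obtain ⟨h1, h2, h3, h4⟩ := hM
    obtain ⟨μ, ν, hμ, hν, rfl⟩ := ih h4
    rw [headD_augment] at h2
    dsimp only at h2
    obtain ⟨x, hx⟩ : ∃ x : ℕ,
        p.1 = (μ.headD (0, i)).1 + |(p.2 : ℤ) - ((μ.headD (0, i)).2 : ℤ)| + x :=
      ⟨(p.1 - (μ.headD (0, i)).1 - |(p.2 : ℤ) - ((μ.headD (0, i)).2 : ℤ)|).toNat, by omega⟩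
    have hxν : ν.headD 0 ≤ x := by omega
    by_cases hc : μ = [] ∧ p.2 = i
    · obtain ⟨rfl, hp⟩ := hc
      have hp1 : p.1 = x := by simpa [hp] using hx
      have hpx : p = ((x : ℤ), i) := Prod.ext hp1 hp
      refine ⟨[], x :: ν, trivial, isPartitionList_cons.2 ⟨hxν, ?_, hν⟩, ?_⟩
      · rcases Nat.eq_zero_or_pos x with rfl | h
        · obtain rfl := hν.eq_nil (by omega)
          exact absurd hpx (h3 (by rw [augment]))
        · exact h
      · rw [augment, hpx]
    · have hflat : FlatChain n i
          (((μ.headD (0, i)).1 + |(p.2 : ℤ) - ((μ.headD (0, i)).2 : ℤ)|, p.2) :: μ) :=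
        ⟨h1, by simp, fun h h' => hc ⟨h, h'⟩, hμ⟩
      rcases Nat.eq_zero_or_pos x with rfl | h
      · obtain rfl := hν.eq_nil (by omega)
        refine ⟨_, [], hflat, hν, ?_⟩
        rw [augment]
        congr 1
        exact Prod.ext (by simpa using hx.symm) rfl
      · refine ⟨_, x :: ν, hflat, isPartitionList_cons.2 ⟨hxν, h, hν⟩, ?_⟩
        rw [augment]
        congr 1
        exact Prod.ext hx.symm rfl

theorem FlatChain.head_eq {n i : ℕ} {p q : ℤ × ℕ} {μ : List (ℤ × ℕ)}
    (hp : FlatChain n i (p :: μ)) (hq : FlatChain n i (q :: μ)) (h : p.2 = q.2) : p = q := by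
  obtain ⟨-, h1, -⟩ := hp
  obtain ⟨-, h2, -⟩ := hq
  refine Prod.ext ?_ h
  rw [h] at h1
  omega

theorem augment_inj {n i : ℕ} {μ μ' : List (ℤ × ℕ)} {ν ν' : List ℕ}
    (hμ : FlatChain n i μ) (hν : IsPartitionList ν) (hμ' : FlatChain n i μ')
    (hν' : IsPartitionList ν') (h : augment i μ ν = augment i μ' ν') : μ = μ' ∧ ν = ν' := by
  induction μ, ν using augment.induct generalizing μ' ν' with
  | case1 =>
    obtain ⟨rfl, rfl⟩ := augment_eq_nil.1 (h.symm.trans (by rw [augment]))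
    exact ⟨rfl, rfl⟩
  | case2 x ν ih =>
    obtain ⟨-, -, hν1⟩ := isPartitionList_cons.1 hν
    match μ', ν' with
    | [], [] => simp [augment] at h
    | [], y :: ν' =>
      simp only [augment, List.cons.injEq, Prod.mk.injEq] at h
      obtain ⟨-, rfl⟩ := ih hμ hν1 hμ' (isPartitionList_cons.1 hν').2.2 h.2
      simpa using h.1
    | q :: μ', [] =>
      simp only [augment, List.cons.injEq] at h
      obtain ⟨rfl, -⟩ := ih hμ hν1 hμ'.2.2.2 hν' h.2
      exact absurd (congrArg Prod.snd h.1).symm (hμ'.2.2.1 rfl)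
    | q :: μ', y :: ν' =>
      simp only [augment, List.cons.injEq] at h
      obtain ⟨rfl, -⟩ := ih hμ hν1 hμ'.2.2.2 (isPartitionList_cons.1 hν').2.2 h.2
      exact absurd (congrArg Prod.snd h.1).symm (hμ'.2.2.1 rfl)
  | case3 p μ ih =>
    match μ', ν' with
    | [], [] => simp [augment] at h
    | [], y :: ν' =>
      simp only [augment, List.cons.injEq] at h
      obtain ⟨rfl, -⟩ := ih hμ.2.2.2 hν hμ' (isPartitionList_cons.1 hν').2.2 h.2
      exact absurd (congrArg Prod.snd h.1) (hμ.2.2.1 rfl)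
    | q :: μ', [] =>
      simp only [augment, List.cons.injEq] at h
      obtain ⟨rfl, -⟩ := ih hμ.2.2.2 hν hμ'.2.2.2 hν' h.2
      exact ⟨by rw [h.1], rfl⟩
    | q :: μ', y :: ν' =>
      obtain ⟨-, hy, hν1'⟩ := isPartitionList_cons.1 hν'
      simp only [augment, List.cons.injEq] at h
      obtain ⟨rfl, -⟩ := ih hμ.2.2.2 hν hμ'.2.2.2 hν1' h.2
      obtain rfl := hμ.head_eq hμ' (by simpa using congrArg Prod.snd h.1)
      have := congrArg Prod.fst h.1
      dsimp only at this
      omega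
  | case4 p μ x ν ih =>
    obtain ⟨-, hx, hν1⟩ := isPartitionList_cons.1 hν
    match μ', ν' with
    | [], [] => simp [augment] at h
    | [], y :: ν' =>
      simp only [augment, List.cons.injEq] at h
      obtain ⟨rfl, -⟩ := ih hμ.2.2.2 hν1 hμ' (isPartitionList_cons.1 hν').2.2 h.2
      exact absurd (congrArg Prod.snd h.1) (hμ.2.2.1 rfl)
    | q :: μ', [] =>
      simp only [augment, List.cons.injEq] at h
      obtain ⟨rfl, -⟩ := ih hμ.2.2.2 hν1 hμ'.2.2.2 hν' h.2
      obtain rfl := hμ.head_eq hμ' (by simpa using congrArg Prod.snd h.1)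
      have := congrArg Prod.fst h.1
      dsimp only at this
      omega
    | q :: μ', y :: ν' =>
      obtain ⟨-, hy, hν1'⟩ := isPartitionList_cons.1 hν'
      simp only [augment, List.cons.injEq] at h
      obtain ⟨rfl, rfl⟩ := ih hμ.2.2.2 hν1 hμ'.2.2.2 hν1' h.2
      obtain rfl := hμ.head_eq hμ' (by simpa using congrArg Prod.snd h.1)
      have := congrArg Prod.fst h.1
      dsimp only at this
      exact ⟨rfl, by congr 1; omega⟩

theorem isPartitionList_sort {t : ℕ} (π : Nat.Partition t) :
    IsPartitionList (π.parts.sort (· ≥ ·)) :=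
  ⟨Multiset.pairwise_sort _ _, fun _ hx => π.parts_pos ((Multiset.mem_sort _).1 hx)⟩

theorem sum_sort_parts {t : ℕ} (π : Nat.Partition t) : (π.parts.sort (· ≥ ·)).sum = t := by
  rw [← Multiset.sum_coe, Multiset.sort_eq, π.parts_sum]

theorem IsPartitionList.exists_sort_eq {ν : List ℕ} (h : IsPartitionList ν) :
    ∃ π : Nat.Partition ν.sum, π.parts.sort (· ≥ ·) = ν :=
  ⟨⟨ν, fun hx => h.2 _ hx, rfl⟩,
    List.Perm.eq_of_pairwise' (Multiset.pairwise_sort _ _) h.1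
      (Multiset.coe_eq_coe.1 (Multiset.sort_eq _ _))⟩

/-- Proposition 3.2 (counting form): `C^≥_{i,n}(m) = ∑_{t=0}^{m} C_{i,n}(m−t) · p(t)`, where
`p(t)` is the number of ordinary partitions of `t`. -/
theorem cgeConvolution (n i m : ℕ) (hi : i ≤ n) :
    Cge n i m = ∑ t ∈ Finset.range (m + 1), Ceq n i (m - t) * Fintype.card (Nat.Partition t) := by
  have (k : ℕ) := finite_flatChain n i k
  simp only [Cge_eq_card _ _ _ hi, Ceq_eq_card_s2 _ _ _ hi, ← Nat.card_eq_fintype_card,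
    ← Nat.card_prod]
  rw [Finset.sum_range, ← Nat.card_sigma]
  symm
  refine Nat.card_eq_of_bijective
    (fun a => ⟨augment i a.2.1.1 (a.2.2.parts.sort (· ≥ ·)),
      gapChain_augment hi a.2.1.2.1 (isPartitionList_sort _), ?_⟩) ⟨?_, ?_⟩
  · rw [sum_augment, a.2.1.2.2, sum_sort_parts]
    have := a.1.2
    omega
  · rintro ⟨⟨t, ht⟩, ⟨μ, hμ⟩, π⟩ ⟨⟨t', ht'⟩, ⟨μ', hμ'⟩, π'⟩ h
    obtain ⟨rfl, h2⟩ := augment_inj hμ.1 (isPartitionList_sort π) hμ'.1 (isPartitionList_sort π')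
      (Subtype.mk.inj h)
    obtain rfl : t = t' :=
      (sum_sort_parts π).symm.trans ((congrArg List.sum h2).trans (sum_sort_parts π'))
    obtain rfl : π = π' := by
      ext1
      rw [← Multiset.sort_eq π.parts (· ≥ ·), h2, Multiset.sort_eq]
    rfl
  · rintro ⟨M, hM, hm⟩
    obtain ⟨μ, ν, hμ, hν, rfl⟩ := exists_augment_eq hM
    obtain ⟨π, hπ⟩ := hν.exists_sort_eq
    rw [sum_augment] at hm
    have := hμ.bounds.1
    refine ⟨⟨⟨ν.sum, by omega⟩, ⟨μ, hμ, ?_⟩, π⟩, Subtype.ext ?_⟩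
    · dsimp only
      omega
    · dsimp only
      rw [hπ]
end

section
/- For all integers n ≥ 0 and 0 ≤ i ≤ n, one has the identity of formal power series in q: ∑_{m≥0} C^≥_{i,n}(m) q^m = (1/(q;q)_∞) · ∑_{m≥0} C_{i,n}(m) q^m. -/
open scoped BigOperators

/-! ### Sums over finitely supported multiplicities -/

/-- The size `∑ (k + 1) d_k` of the partition with `d_k` parts equal to `k + 1`. -/
noncomputable def partitionSize : (ℕ →₀ ℕ) →+ ℕ := Finsupp.weight fun k => k + 1

/-- The `j`-th part of the conjugate partition, `∑_{k ≥ j} d_k`. -/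
noncomputable def conjugatePart (j : ℕ) : (ℕ →₀ ℕ) →+ ℕ :=
  Finsupp.weight fun k => if j ≤ k then 1 else 0

lemma conjugatePart_eq_add_succ (d : ℕ →₀ ℕ) (j : ℕ) :
    conjugatePart j d = d j + conjugatePart (j + 1) d := by
  induction d using Finsupp.induction_linear with
  | zero => simp
  | add f g hf hg => simp only [map_add, Finsupp.add_apply]; omega
  | single a b =>
    simp only [conjugatePart, Finsupp.weight_single, Finsupp.single_apply, smul_eq_mul]
    rcases lt_trichotomy a j with h | h | h <;> grind

lemma conjugatePart_eventually_zero (d : ℕ →₀ ℕ) : ∃ N, ∀ j ≥ N, conjugatePart j d = 0 := by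
  refine ⟨d.support.sup id + 1, fun j hj => ?_⟩
  rw [conjugatePart, Finsupp.weight_apply]
  refine Finset.sum_eq_zero fun k hk => ?_
  have : k ≤ d.support.sup id := Finset.le_sup (f := id) hk
  simp only [smul_eq_mul, mul_ite, mul_one, mul_zero, ite_eq_right_iff]
  omega

lemma sum_range_conjugatePart (d : ℕ →₀ ℕ) (N : ℕ) (h : ∀ j ≥ N, conjugatePart j d = 0) :
    ∑ j ∈ Finset.range N, conjugatePart j d = partitionSize d := by
  have hsupp : ∀ k ∈ d.support, k < N := by
    intro k hk
    by_contra! hle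
    have h1 := conjugatePart_eq_add_succ d k
    have h2 := h k hle
    have h3 := Finsupp.mem_support_iff.mp hk
    omega
  simp only [conjugatePart, partitionSize, Finsupp.weight_apply, Finsupp.sum]
  rw [Finset.sum_comm]
  refine Finset.sum_congr rfl fun k hk => ?_
  rw [← Finset.smul_sum]
  congr 1
  rw [← Finset.sum_filter, Finset.sum_const, smul_eq_mul, mul_one]
  have : (Finset.range N).filter (fun j => j ≤ k) = Finset.range (k + 1) := by
    ext j
    have := hsupp k hk
    simp only [Finset.mem_filter, Finset.mem_range]
    omega
  rw [this, Finset.card_range]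

lemma hasSum_fin_prod_pow {𝕜 : Type*} [RCLike 𝕜] {N : ℕ} (x : Fin N → 𝕜) (hx : ∀ j, ‖x j‖ < 1) :
    HasSum (fun v : Fin N → ℕ => ∏ j, x j ^ v j) (∏ j, (1 - x j)⁻¹) := by
  induction N with
  | zero => simp
  | succ N ih =>
    have h0 := hasSum_geometric_of_norm_lt_one (hx 0)
    have h1 := ih (fun j => x j.succ) fun j => hx _
    have hs := summable_mul_of_summable_norm h0.summable.norm h1.summable.norm
    have hm := h0.mul h1 hs
    rw [Fin.prod_univ_succ, ← (Fin.consEquiv fun _ : Fin (N + 1) => ℕ).hasSum_iff]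
    simpa [Function.comp_def, Fin.prod_univ_succ, Fin.consEquiv] using hm

/-- Extension of a finite sequence by zero. -/
noncomputable def extendByZero (N : ℕ) (v : Fin N → ℕ) : ℕ →₀ ℕ :=
  Finsupp.onFinset (Finset.range N) (fun j => if h : j < N then v ⟨j, h⟩ else 0)
    (by intro a; simp only [Finset.mem_range]; grind)

lemma extendByZero_apply_fin {N : ℕ} (v : Fin N → ℕ) (j : Fin N) :
    extendByZero N v j = v j := by
  simp [extendByZero]

lemma extendByZero_injective (N : ℕ) : Function.Injective (extendByZero N) := by
  intro v w h
  ext j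
  rw [← extendByZero_apply_fin v, h, extendByZero_apply_fin]

lemma mem_range_extendByZero {N : ℕ} {d : ℕ →₀ ℕ} (h : ∀ j ≥ N, d j = 0) :
    d ∈ Set.range (extendByZero N) := by
  refine ⟨fun j => d j, ?_⟩
  ext j
  simp only [extendByZero, Finsupp.onFinset_apply]
  split_ifs with hj
  · rfl
  · exact (h j (not_lt.mp hj)).symm

lemma partitionSize_extendByZero {N : ℕ} (v : Fin N → ℕ) :
    partitionSize (extendByZero N v) = ∑ j, v j * (j + 1) := by
  rw [partitionSize, Finsupp.weight_apply, Finsupp.sum_of_support_subset (extendByZero N v)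
    (s := Finset.range N) Finsupp.support_onFinset_subset _ (by simp), Finset.sum_range]
  simp [extendByZero_apply_fin]

lemma hasSum_boundedParts {𝕜 : Type*} [RCLike 𝕜] {x : 𝕜} (hx : ‖x‖ < 1) (N : ℕ) :
    HasSum ((Set.range (extendByZero N)).indicator fun d => x ^ partitionSize d)
      (∏ j ∈ Finset.range N, (1 - x ^ (j + 1))⁻¹) := by
  have h := hasSum_fin_prod_pow (fun j : Fin N => x ^ ((j : ℕ) + 1)) fun j => by
    rw [norm_pow]; exact pow_lt_one₀ (norm_nonneg _) hx (by omega)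
  rw [← (extendByZero_injective N).hasSum_iff
    (fun d hd => Set.indicator_of_notMem hd _), Finset.prod_range]
  convert h using 2 with v
  simp only [Function.comp_apply, Set.indicator_of_mem (Set.mem_range_self v),
    partitionSize_extendByZero, ← pow_mul, Finset.prod_pow_eq_pow_sum]
  congr 1
  exact Finset.sum_congr rfl fun _ _ => mul_comm _ _

lemma tendsto_prod_inv_one_sub_pow {x : ℂ} (hx : ‖x‖ < 1) :
    Filter.Tendsto (fun N => ∏ j ∈ Finset.range N, (1 - x ^ (j + 1))⁻¹) Filter.atTop
      (nhds (1 / qPoch x x)) := by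
  have hne : qPoch x x ≠ 0 := by
    have := tprod_one_add_ne_zero_of_summable (f := fun j : ℕ => -x ^ (j + 1))
      (fun j => by
        intro h0
        have h1 : ‖x ^ (j + 1)‖ < 1 := by
          rw [norm_pow]; exact pow_lt_one₀ (norm_nonneg _) hx (by omega)
        have h2 : x ^ (j + 1) = 1 := by linear_combination -h0
        rw [h2, norm_one] at h1
        exact lt_irrefl _ h1)
      (by
        simpa using (summable_nat_add_iff 1).mpr
          (summable_geometric_of_lt_one (norm_nonneg _) hx))
    simpa only [qPoch, ← pow_succ', sub_eq_add_neg] using this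
  have hm := (ModularForm.multipliable_one_sub_pow hx).hasProd.tendsto_prod_nat
  simp only [Finset.prod_inv_distrib, one_div]
  refine Filter.Tendsto.inv₀ ?_ hne
  simpa only [qPoch, ← pow_succ'] using hm

lemma eventually_mem_range_extendByZero (d : ℕ →₀ ℕ) :
    ∀ᶠ N in Filter.atTop, d ∈ Set.range (extendByZero N) := by
  filter_upwards [Filter.eventually_gt_atTop (d.support.sup id)] with N hN
  refine mem_range_extendByZero fun j hj => ?_
  by_contra h
  have : j ≤ d.support.sup id := Finset.le_sup (f := id) (Finsupp.mem_support_iff.mpr h)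
  omega

lemma summable_pow_partitionSize {r : ℝ} (h0 : 0 ≤ r) (h1 : r < 1) :
    Summable fun d : ℕ →₀ ℕ => r ^ partitionSize d := by
  have hr : ‖r‖ < 1 := by rwa [Real.norm_of_nonneg h0]
  have hc : ‖(r : ℂ)‖ < 1 := by simpa using hr
  obtain ⟨C, hC⟩ := (tendsto_prod_inv_one_sub_pow hc).norm.bddAbove_range
  refine summable_of_sum_le (c := C) (fun d => pow_nonneg h0 _) fun s => ?_
  obtain ⟨N, hN⟩ := ((Filter.eventually_all_finset s).mpr
    fun d _ => eventually_mem_range_extendByZero d).exists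
  calc ∑ d ∈ s, r ^ partitionSize d
      = ∑ d ∈ s, (Set.range (extendByZero N)).indicator (fun d => r ^ partitionSize d) d :=
        Finset.sum_congr rfl fun d hd => (Set.indicator_of_mem (hN d hd) fun d => r ^ partitionSize d).symm
    _ ≤ ∏ j ∈ Finset.range N, (1 - r ^ (j + 1))⁻¹ :=
        sum_le_hasSum s (fun d _ => Set.indicator_nonneg (fun _ _ => pow_nonneg h0 _) _)
          (hasSum_boundedParts hr N)
    _ ≤ ‖((∏ j ∈ Finset.range N, (1 - r ^ (j + 1))⁻¹ : ℝ) : ℂ)‖ := by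
        rw [Complex.norm_real]; exact le_abs_self _
    _ ≤ C := hC ⟨N, by push_cast; rfl⟩

lemma tsum_pow_partitionSize {q : ℂ} (hq : ‖q‖ < 1) :
    ∑' d : ℕ →₀ ℕ, q ^ partitionSize d = 1 / qPoch q q := by
  have h := tendsto_tsum_of_dominated_convergence
    (f := fun N => (Set.range (extendByZero N)).indicator fun d => q ^ partitionSize d)
    (𝓕 := Filter.atTop) (g := fun d => q ^ partitionSize d)
    (summable_pow_partitionSize (norm_nonneg q) hq)
    (fun d => tendsto_const_nhds.congr' <| by
      filter_upwards [eventually_mem_range_extendByZero d] with N hN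
      exact (Set.indicator_of_mem hN fun d => q ^ partitionSize d).symm)
    (Filter.Eventually.of_forall fun N d => by
      rw [← norm_pow]; exact norm_indicator_le_norm_self _ _)
  simp only [(hasSum_boundedParts hq _).tsum_eq] at h
  exact tendsto_nhds_unique h (tendsto_prod_inv_one_sub_pow hq)

lemma tsum_ncard_fiber_mul_pow {X : Type*} (w : X → ℕ) (q : ℂ)
    (h : Summable fun x => q ^ w x) :
    ∑' m : ℕ, ((w ⁻¹' {m}).ncard : ℂ) * q ^ m = ∑' x, q ^ w x := by
  have hs : Summable fun p : Σ m, {x // w x = m} => q ^ w p.2.1 :=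
    (Equiv.sigmaFiberEquiv w).summable_iff.mpr h
  rw [← (Equiv.sigmaFiberEquiv w).tsum_eq fun x => q ^ w x]
  refine Eq.trans ?_ hs.tsum_sigma.symm
  refine tsum_congr fun m => ?_
  have : ∀ c : {x // w x = m}, q ^ w c.1 = q ^ m := fun c => by rw [c.2]
  simp only [this]
  rw [tsum_const, nsmul_eq_mul]
  rfl

/-! ### Lists as eventually constant sequences -/

section Truncation

variable {α : Type*}

/-- The list of values of an eventually constant sequence, up to the first index from which on
it equals `z`. -/
noncomputable def truncateAt (z : α) (f : ℕ → α) : List α :=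
  (List.range (sInf {N | ∀ j ≥ N, f j = z} + 1)).map f

variable {z : α} {f : ℕ → α}

lemma eq_of_sInf_le (hf : ∃ N, ∀ j ≥ N, f j = z) {j : ℕ}
    (hj : sInf {N | ∀ j ≥ N, f j = z} ≤ j) : f j = z :=
  Nat.sInf_mem (s := {N | ∀ j ≥ N, f j = z}) hf j hj

lemma getD_truncateAt (hf : ∃ N, ∀ j ≥ N, f j = z) (j : ℕ) :
    (truncateAt z f).getD j z = f j := by
  by_cases hj : j < sInf {N | ∀ j ≥ N, f j = z} + 1
  · simp [truncateAt, List.getD_eq_getElem?_getD, List.getElem?_range hj]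
  · rw [List.getD_eq_default _ _ (by simpa [truncateAt] using hj),
      eq_of_sInf_le hf (by omega)]

lemma getLast?_truncateAt (hf : ∃ N, ∀ j ≥ N, f j = z) :
    (truncateAt z f).getLast? = some z := by
  simp [truncateAt, List.range_succ, eq_of_sInf_le hf le_rfl]

lemma penultimate_truncateAt (hf : ∃ N, ∀ j ≥ N, f j = z) :
    ∀ p ∈ (truncateAt z f).reverse[1]?, p ≠ z := by
  rcases hN : sInf {N | ∀ j ≥ N, f j = z} with _ | k
  · simp [truncateAt, hN]
  · have hne : f k ≠ z := by
      intro hk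
      have : sInf {N | ∀ j ≥ N, f j = z} ≤ k := Nat.sInf_le fun j hj => by
        rcases hj.eq_or_lt with rfl | hj
        · exact hk
        · exact eq_of_sInf_le hf (by omega)
      omega
    simpa [truncateAt, hN, List.range_succ] using hne

lemma truncateAt_getD {L : List α} (hlast : L.getLast? = some z)
    (hpen : ∀ p ∈ L.reverse[1]?, p ≠ z) :
    (∃ N, ∀ j ≥ N, L.getD j z = z) ∧ truncateAt z (fun j => L.getD j z) = L := by
  obtain ⟨M, rfl⟩ := List.getLast?_eq_some_iff.mp hlast
  have hmem : ∀ j ≥ M.length, (M ++ [z]).getD j z = z := by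
    intro j hj
    rcases hj.eq_or_lt with rfl | hj
    · simp
    · exact List.getD_eq_default _ _ (by simpa using hj)
  have hsInf : sInf {N | ∀ j ≥ N, (M ++ [z]).getD j z = z} = M.length := by
    refine IsLeast.csInf_eq ⟨hmem, fun N hN => ?_⟩
    by_contra! hlt
    have hne : M ≠ [] := by rintro rfl; simp at hlt
    have hz := hN (M.length - 1) (by omega)
    have h1 : M.length - 1 < M.length := by omega
    refine hpen _ ?_ hz
    rw [List.getD_eq_getElem _ _ (by simp), List.getElem_append_left h1]
    simp [List.getElem?_reverse (List.length_pos_iff.mpr hne), List.getElem?_eq_getElem h1]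
  refine ⟨⟨_, hmem⟩, ?_⟩
  rw [truncateAt, hsInf]
  refine List.ext_getElem (by simp) fun j h1 h2 => ?_
  simp [List.getD_eq_getElem?_getD, List.getElem?_eq_getElem h2]

lemma forall_mem_truncateAt (hf : ∃ N, ∀ j ≥ N, f j = z) {P : α → Prop} :
    (∀ p ∈ truncateAt z f, P p) ↔ ∀ j, P (f j) := by
  simp only [truncateAt, List.forall_mem_map, List.mem_range]
  refine ⟨fun h j => ?_, fun h j _ => h j⟩
  by_cases hj : j < sInf {N | ∀ j ≥ N, f j = z} + 1
  · exact h j hj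
  · rw [eq_of_sInf_le hf (by omega), ← eq_of_sInf_le hf le_rfl]
    exact h _ (Nat.lt_succ_self _)

lemma isChain_truncateAt (hf : ∃ N, ∀ j ≥ N, f j = z) {R : α → α → Prop} (hR : R z z) :
    (truncateAt z f).IsChain R ↔ ∀ j, R (f j) (f (j + 1)) := by
  rw [truncateAt, List.isChain_map, List.isChain_range_succ]
  refine ⟨fun h j => ?_, fun h j _ => h j⟩
  by_cases hj : j < sInf {N | ∀ j ≥ N, f j = z}
  · exact h j hj
  · rw [eq_of_sInf_le hf (by omega), eq_of_sInf_le hf (by omega)]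
    exact hR

end Truncation

/-! ### Coloured partitions as colour sequences with excesses -/

/-- Sequences of colours bounded by `n` that are eventually equal to `i`. -/
abbrev ColourSeq (n i : ℕ) : Type :=
  {u : ℕ → ℕ // (∀ j, u j ≤ n) ∧ ∃ N, ∀ j ≥ N, u j = i}

namespace ColourSeq

variable {n i : ℕ}

lemma eventually_eq_succ (u : ColourSeq n i) : ∃ N, ∀ j ≥ N, u.1 j = u.1 (j + 1) := by
  obtain ⟨N, hN⟩ := u.2.2
  exact ⟨N, fun j hj => by rw [hN j hj, hN (j + 1) (by omega)]⟩

/-- The descents of a colour sequence. -/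
noncomputable def descent (u : ColourSeq n i) : ℕ →₀ ℕ :=
  Finsupp.ofSupportFinite (fun j => u.1 j - u.1 (j + 1)) <| by
    obtain ⟨N, hN⟩ := u.eventually_eq_succ
    refine (Set.finite_lt_nat N).subset fun j hj => ?_
    by_contra h
    exact hj (by simp [hN j (not_lt.mp h)])

/-- The ascents of a colour sequence. -/
noncomputable def ascent (u : ColourSeq n i) : ℕ →₀ ℕ :=
  Finsupp.ofSupportFinite (fun j => u.1 (j + 1) - u.1 j) <| by
    obtain ⟨N, hN⟩ := u.eventually_eq_succ
    refine (Set.finite_lt_nat N).subset fun j hj => ?_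
    by_contra h
    exact hj (by simp [hN j (not_lt.mp h)])

@[simp] lemma descent_apply (u : ColourSeq n i) (j : ℕ) :
    u.descent j = u.1 j - u.1 (j + 1) := rfl

@[simp] lemma ascent_apply (u : ColourSeq n i) (j : ℕ) :
    u.ascent j = u.1 (j + 1) - u.1 j := rfl

/-- The absolute values of the successive differences of a colour sequence. -/
noncomputable def variation (u : ColourSeq n i) : ℕ →₀ ℕ := u.descent + u.ascent

lemma variation_cast (u : ColourSeq n i) (j : ℕ) :
    (u.variation j : ℤ) = |(u.1 j : ℤ) - u.1 (j + 1)| := by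
  simp only [variation, Finsupp.add_apply, descent_apply, ascent_apply]
  rcases abs_cases ((u.1 j : ℤ) - u.1 (j + 1)) with h | h <;> omega

end ColourSeq

lemma eq_of_eventually_eq_of_sub_eq {f g : ℕ → ℤ} (he : ∃ N, ∀ j ≥ N, f j = g j)
    (h : ∀ j, f j - f (j + 1) = g j - g (j + 1)) : f = g := by
  obtain ⟨N, hN⟩ := he
  induction N with
  | zero => exact funext fun j => hN j (Nat.zero_le _)
  | succ N ih =>
    refine ih fun j hj => ?_
    rcases hj.eq_or_lt with rfl | hj
    · linarith [h N, hN (N + 1) le_rfl]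
    · exact hN j hj

namespace ColourSeq

variable {n i : ℕ}

lemma descent_ascent_injective :
    Function.Injective fun u : ColourSeq n i => (u.descent, u.ascent) := by
  intro u v h
  obtain ⟨N, hN⟩ := u.2.2
  obtain ⟨M, hM⟩ := v.2.2
  have key : (fun j => (u.1 j : ℤ)) = fun j => (v.1 j : ℤ) := by
    refine eq_of_eventually_eq_of_sub_eq ⟨N + M, fun j hj => ?_⟩ fun j => ?_
    · rw [hN j (by omega), hM j (by omega)]
    · have h1 := DFunLike.congr_fun (congrArg Prod.fst h) j
      have h2 := DFunLike.congr_fun (congrArg Prod.snd h) j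
      simp only [descent_apply, ascent_apply] at h1 h2
      omega
  exact Subtype.ext (funext fun j => by exact_mod_cast congrFun key j)

lemma summable_pow_partitionSize_variation {r : ℝ} (h0 : 0 ≤ r) (h1 : r < 1) :
    Summable fun u : ColourSeq n i => r ^ partitionSize u.variation := by
  have h := summable_pow_partitionSize h0 h1
  have hm := (h.mul_of_nonneg h (fun _ => pow_nonneg h0 _) fun _ => pow_nonneg h0 _).comp_injective
    (descent_ascent_injective (n := n) (i := i))
  simpa only [Function.comp_def, ← pow_add, ← map_add, variation] using hm

/-- The sequence of coloured parts with colours `u` and excesses `d`. -/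
noncomputable def parts (u : ColourSeq n i) (d : ℕ →₀ ℕ) (j : ℕ) : ℤ × ℕ :=
  (conjugatePart j (u.variation + d), u.1 j)

lemma parts_eventually (u : ColourSeq n i) (d : ℕ →₀ ℕ) :
    ∃ N, ∀ j ≥ N, u.parts d j = (0, i) := by
  obtain ⟨N, hN⟩ := u.2.2
  obtain ⟨M, hM⟩ := conjugatePart_eventually_zero (u.variation + d)
  exact ⟨N + M, fun j hj => by rw [parts, hN j (by omega), hM j (by omega)]; rfl⟩

lemma parts_sub (u : ColourSeq n i) (d : ℕ →₀ ℕ) (j : ℕ) :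
    (u.parts d j).1 - (u.parts d (j + 1)).1 = |(u.1 j : ℤ) - u.1 (j + 1)| + d j := by
  simp only [parts]
  rw [conjugatePart_eq_add_succ _ j, ← variation_cast]
  push_cast [Finsupp.add_apply]
  ring

/-- The coloured partition with colours `u` and excesses `d`. -/
noncomputable def toList (u : ColourSeq n i) (d : ℕ →₀ ℕ) : List (ℤ × ℕ) :=
  truncateAt (0, i) (u.parts d)

lemma toList_injective :
    Function.Injective fun p : ColourSeq n i × (ℕ →₀ ℕ) => p.1.toList p.2 := by
  rintro ⟨u, d⟩ ⟨v, e⟩ h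
  have hp : ∀ j, u.parts d j = v.parts e j := fun j => by
    rw [← getD_truncateAt (u.parts_eventually d), ← getD_truncateAt (v.parts_eventually e)]
    exact congrArg (fun L => L.getD j (0, i)) h
  obtain rfl : u = v := Subtype.ext (funext fun j => congrArg Prod.snd (hp j))
  refine Prod.ext rfl (Finsupp.ext fun j => ?_)
  have h1 := u.parts_sub d j
  rw [hp, hp, u.parts_sub e j] at h1
  simpa using h1.symm

lemma sum_toList (u : ColourSeq n i) (d : ℕ →₀ ℕ) :
    ((u.toList d).map Prod.fst).sum = (partitionSize (u.variation + d) : ℤ) := by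
  have hz : ∀ j ≥ sInf {N | ∀ j ≥ N, u.parts d j = (0, i)} + 1,
      conjugatePart j (u.variation + d) = 0 := fun j hj => by
    have := congrArg Prod.fst (eq_of_sInf_le (u.parts_eventually d) (j := j) (by omega))
    exact Int.ofNat_eq_zero.mp this
  rw [← sum_range_conjugatePart _ _ hz, toList, truncateAt, List.map_map,
    ← List.sum_toFinset _ List.nodup_range, List.toFinset_range]
  push_cast
  rfl

lemma exists_parts_eq {f : ℕ → ℤ × ℕ} (hf : ∃ N, ∀ j ≥ N, f j = (0, i))
    (hn : ∀ j, (f j).2 ≤ n)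
    (hge : ∀ j, (f j).1 - (f (j + 1)).1 ≥ |((f j).2 : ℤ) - ((f (j + 1)).2 : ℤ)|) :
    ∃ (u : ColourSeq n i) (d : ℕ →₀ ℕ), u.parts d = f := by
  obtain ⟨N, hN⟩ := hf
  let u : ColourSeq n i := ⟨fun j => (f j).2, hn, N, fun j hj => by simp [hN j hj]⟩
  let d : ℕ →₀ ℕ := Finsupp.ofSupportFinite
    (fun j => ((f j).1 - (f (j + 1)).1 - |((f j).2 : ℤ) - ((f (j + 1)).2 : ℤ)|).toNat) <| by
      refine (Set.finite_lt_nat N).subset fun j hj => ?_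
      by_contra h
      have h' : N ≤ j := not_lt.mp h
      exact hj (by simp [hN j h', hN (j + 1) (by omega)])
  have hd : ∀ j, (d j : ℤ) = (f j).1 - (f (j + 1)).1 - |((f j).2 : ℤ) - ((f (j + 1)).2 : ℤ)| :=
    fun j => Int.toNat_of_nonneg (by linarith [hge j])
  refine ⟨u, d, ?_⟩
  have key : (fun j => (u.parts d j).1) = fun j => (f j).1 := by
    refine eq_of_eventually_eq_of_sub_eq ?_ fun j => ?_
    · obtain ⟨M, hM⟩ := u.parts_eventually d
      exact ⟨N + M, fun j hj => by rw [hM j (by omega), hN j (by omega)]⟩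
    · rw [parts_sub, hd]
      simp only [u]
      ring
  exact funext fun j => Prod.ext (congrFun key j) rfl

lemma toList_mem_CgeSet_iff (u : ColourSeq n i) (d : ℕ →₀ ℕ) (m : ℕ) :
    u.toList d ∈ CgeSet n i m ↔ partitionSize (u.variation + d) = m := by
  have hf := u.parts_eventually d
  refine ⟨fun h => ?_, fun h => ⟨(forall_mem_truncateAt hf (P := fun p => p.2 ≤ n)).mpr u.2.1,
    (isChain_truncateAt hf (by simp)).mpr fun j => ?_, getLast?_truncateAt hf,
    penultimate_truncateAt hf, ?_⟩⟩
  · exact_mod_cast (u.sum_toList d).symm.trans h.2.2.2.2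
  · rw [parts_sub]
    simp [parts]
  · rw [sum_toList, h]

lemma exists_toList_eq_of_mem_CgeSet {m : ℕ} {L : List (ℤ × ℕ)} (hL : L ∈ CgeSet n i m) :
    ∃ (u : ColourSeq n i) (d : ℕ →₀ ℕ), u.toList d = L := by
  obtain ⟨hn, hc, hlast, hpen, -⟩ := hL
  obtain ⟨hf, hL⟩ := truncateAt_getD hlast hpen
  rw [← hL] at hn hc
  obtain ⟨u, d, h⟩ := exists_parts_eq hf ((forall_mem_truncateAt hf (P := fun p => p.2 ≤ n)).mp hn)
    ((isChain_truncateAt hf (by simp)).mp hc)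
  exact ⟨u, d, by rw [toList, h, hL]⟩

lemma CeqSet_subset_CgeSet (n i m : ℕ) : CeqSet n i m ⊆ CgeSet n i m :=
  fun _ ⟨hn, hc, hlast, hpen, hsum⟩ =>
    ⟨hn, List.IsChain.imp (fun _ _ h => h.ge) hc, hlast,
      fun p hp h => hpen p hp (congrArg Prod.snd h), hsum⟩

lemma toList_mem_CeqSet_iff (u : ColourSeq n i) (d : ℕ →₀ ℕ) (m : ℕ) :
    u.toList d ∈ CeqSet n i m ↔ d = 0 ∧ partitionSize u.variation = m := by
  have hf := u.parts_eventually d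
  constructor
  · intro h
    have hd : d = 0 := Finsupp.ext fun j => by
      have h1 := (isChain_truncateAt hf (by simp)).mp h.2.1 j
      rw [parts_sub] at h1
      simpa [parts] using h1
    refine ⟨hd, ?_⟩
    have := (u.toList_mem_CgeSet_iff d m).mp (CeqSet_subset_CgeSet n i m h)
    rwa [hd, add_zero] at this
  · rintro ⟨rfl, h⟩
    obtain ⟨hn, -, hlast, hpen, hsum⟩ := (u.toList_mem_CgeSet_iff 0 m).mpr (by rwa [add_zero])
    have hc : List.IsChain (fun x y : ℤ × ℕ => x.1 - y.1 = |(x.2 : ℤ) - (y.2 : ℤ)|)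
        (u.toList 0) := (isChain_truncateAt hf (by simp)).mpr fun j => by
      rw [parts_sub]
      simp [parts]
    refine ⟨hn, hc, hlast, fun p hp hpi => hpen p hp (Prod.ext ?_ hpi), hsum⟩
    obtain ⟨M, hM⟩ := List.getLast?_eq_some_iff.mp hlast
    rw [hM] at hp hc
    rcases List.eq_nil_or_concat M with rfl | ⟨K, y, rfl⟩
    · simp at hp
    · obtain rfl : y = p := by simpa using hp
      have := hc.right_of_append
      simp_all [List.isChain_append]

end ColourSeq

lemma Cge_eq_ncard (n i m : ℕ) :
    Cge n i m = ((fun p : ColourSeq n i × (ℕ →₀ ℕ) =>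
      partitionSize (p.1.variation + p.2)) ⁻¹' {m}).ncard := by
  rw [Cge, ← Set.ncard_image_of_injective _ ColourSeq.toList_injective]
  congr 1
  ext L
  constructor
  · intro hL
    obtain ⟨u, d, rfl⟩ := ColourSeq.exists_toList_eq_of_mem_CgeSet hL
    exact ⟨(u, d), (u.toList_mem_CgeSet_iff d m).mp hL, rfl⟩
  · rintro ⟨p, hp, rfl⟩
    exact (p.1.toList_mem_CgeSet_iff p.2 m).mpr hp

lemma Ceq_eq_ncard (n i m : ℕ) :
    Ceq n i m = ((fun u : ColourSeq n i => partitionSize u.variation) ⁻¹' {m}).ncard := by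
  have hinj : Function.Injective fun u : ColourSeq n i => u.toList 0 := fun u v h =>
    congrArg Prod.fst (ColourSeq.toList_injective (a₁ := (u, 0)) (a₂ := (v, 0)) h)
  rw [Ceq, ← Set.ncard_image_of_injective _ hinj]
  congr 1
  ext L
  constructor
  · intro hL
    obtain ⟨u, d, rfl⟩ := ColourSeq.exists_toList_eq_of_mem_CgeSet
      (ColourSeq.CeqSet_subset_CgeSet n i m hL)
    obtain ⟨rfl, h⟩ := (u.toList_mem_CeqSet_iff d m).mp hL
    exact ⟨u, h, rfl⟩
  · rintro ⟨u, hu, rfl⟩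
    exact (u.toList_mem_CeqSet_iff 0 m).mpr ⟨rfl, hu⟩

/-- `∑_{m≥0} C^≥_{i,n}(m) qᵐ = (1/(q;q)_∞) · ∑_{m≥0} C_{i,n}(m) qᵐ`. -/
theorem cgeGenFun (n i : ℕ) (hi : i ≤ n) (q : ℂ) (hq : ‖q‖ < 1) :
    ∑' m : ℕ, (Cge n i m : ℂ) * q ^ m =
      (1 / qPoch q q) * ∑' m : ℕ, (Ceq n i m : ℂ) * q ^ m := by
  have hU : Summable fun u : ColourSeq n i => ‖q ^ partitionSize u.variation‖ := by
    simpa only [norm_pow] using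
      ColourSeq.summable_pow_partitionSize_variation (norm_nonneg q) hq
  have hD : Summable fun d : ℕ →₀ ℕ => ‖q ^ partitionSize d‖ := by
    simpa only [norm_pow] using summable_pow_partitionSize (norm_nonneg q) hq
  have hUD := summable_mul_of_summable_norm hU hD
  simp only [Cge_eq_ncard, Ceq_eq_ncard]
  rw [tsum_ncard_fiber_mul_pow _ _ hU.of_norm, tsum_ncard_fiber_mul_pow _ _
    (by simpa only [map_add, pow_add] using hUD)]
  simp only [map_add, pow_add]
  rw [← tsum_mul_tsum_of_summable_norm hU hD, tsum_pow_partitionSize hq, mul_comm]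
end

section
/- For all integers n ≥ 0, 0 ≤ i ≤ n and m ≥ 0, C_{i,n}(m) equals the number of finite sequences (j_0, …, j_{s−1}) with s ≥ 0, each j_l ∈ {0, 1, …, n}, and j_{s−1} ≠ i when s ≥ 1, such that, setting j_s := i, one has ∑_{l=0}^{s−1} (l+1)·|j_l − j_{l+1}| = m. (Concretely, the map sending such a sequence to the coloured partition whose k-th part is ∑_{l=k}^{s−1} |j_l − j_{l+1}| with colour c_{j_k}, followed by a final part 0 with colour c_i, is a weight-preserving bijection onto the set counted by C_{i,n}.) -/
open scoped BigOperators

/-- Finite sequences `(j_0, …, j_{s−1})` with entries in `{0,…,n}`, last entry `≠ i` (when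
nonempty), such that, with `j_s := i` (realised by appending `i` to the list),
`∑_{l=0}^{s−1} (l+1)·|j_l − j_{l+1}| = m`. -/
def SeqSet (n i m : ℕ) : Set (List ℕ) :=
  {J | (∀ j ∈ J, j ≤ n) ∧
       (∀ j ∈ J.getLast?, j ≠ i) ∧
       ∑ l ∈ Finset.range J.length,
         ((l : ℤ) + 1) * |((J ++ [i]).getD l 0 : ℤ) - ((J ++ [i]).getD (l + 1) 0 : ℤ)|
         = (m : ℤ)}

/-- The sum of the consecutive gaps of `J ++ [i]`, the largest part of the coloured partition
attached to `J`. -/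
def gapSum (i : ℕ) : List ℕ → ℤ
  | [] => 0
  | j :: J => gapSum i J + |(j : ℤ) - (J.headD i : ℤ)|

/-- The coloured partition with colour sequence `J ++ [i]`, last part `0`, and consecutive
differences equal to the colour gaps. -/
def toParts (i : ℕ) : List ℕ → List (ℤ × ℕ)
  | [] => [(0, i)]
  | j :: J => (gapSum i (j :: J), j) :: toParts i J

theorem head?_toParts (i : ℕ) (J : List ℕ) :
    (toParts i J).head? = some (gapSum i J, J.headD i) := by
  cases J <;> simp [toParts, gapSum]

theorem map_snd_toParts (i : ℕ) (J : List ℕ) : (toParts i J).map Prod.snd = J ++ [i] := by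
  induction J with
  | nil => rfl
  | cons j J ih => simp [toParts, ih]

theorem toParts_injective (i : ℕ) : Function.Injective (toParts i) := fun J K h => by
  simpa [map_snd_toParts] using congrArg (List.map Prod.snd) h

theorem getLast?_toParts (i : ℕ) (J : List ℕ) : (toParts i J).getLast? = some (0, i) := by
  induction J with
  | nil => rfl
  | cons j J ih => simp [toParts, List.getLast?_cons, ih]

theorem isChain_toParts (i : ℕ) (J : List ℕ) :
    List.IsChain (fun x y : ℤ × ℕ => x.1 - y.1 = |(x.2 : ℤ) - (y.2 : ℤ)|) (toParts i J) := by
  induction J with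
  | nil => simp [toParts]
  | cons j J ih =>
    rw [toParts, List.isChain_cons]
    refine ⟨fun y hy => ?_, ih⟩
    rw [head?_toParts, Option.mem_some_iff] at hy
    subst hy
    simp [gapSum]

theorem exists_toParts_eq (i : ℕ) (L : List (ℤ × ℕ))
    (hL : List.IsChain (fun x y : ℤ × ℕ => x.1 - y.1 = |(x.2 : ℤ) - (y.2 : ℤ)|) L)
    (hlast : L.getLast? = some (0, i)) : ∃ J, toParts i J = L := by
  induction L with
  | nil => simp at hlast
  | cons x L ih =>
    rcases L.eq_nil_or_concat' with rfl | ⟨_, _, hne⟩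
    · exact ⟨[], by simpa [toParts, eq_comm] using hlast⟩
    · rw [List.isChain_cons] at hL
      obtain ⟨J, rfl⟩ := ih hL.2 (by simpa [hne, List.getLast?_cons] using hlast)
      have h := hL.1 _ (head?_toParts i J)
      refine ⟨x.2 :: J, ?_⟩
      rw [toParts, gapSum, ← h]
      simp

theorem getElem?_one_reverse_toParts (i : ℕ) (J : List ℕ) :
    (toParts i J).reverse[1]?.map Prod.snd = J.getLast? := by
  rw [← List.getElem?_map, List.map_reverse, map_snd_toParts]
  simp [← List.head?_eq_getElem?]

theorem gapSum_eq_sum (i : ℕ) (J : List ℕ) :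
    gapSum i J = ∑ l ∈ Finset.range J.length,
      |((J ++ [i]).getD l 0 : ℤ) - ((J ++ [i]).getD (l + 1) 0 : ℤ)| := by
  induction J with
  | nil => rfl
  | cons j J ih =>
    rw [gapSum, ih, List.length_cons, Finset.sum_range_succ']
    cases J <;> simp

theorem sum_map_fst_toParts (i : ℕ) (J : List ℕ) :
    ((toParts i J).map Prod.fst).sum = ∑ l ∈ Finset.range J.length,
      ((l : ℤ) + 1) * |((J ++ [i]).getD l 0 : ℤ) - ((J ++ [i]).getD (l + 1) 0 : ℤ)| := by
  induction J with
  | nil => rfl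
  | cons j J ih =>
    have hsplit : ∀ f : ℕ → ℤ, ∑ l ∈ Finset.range J.length, ((l : ℤ) + 1 + 1) * f l =
        ∑ l ∈ Finset.range J.length, f l + ∑ l ∈ Finset.range J.length, ((l : ℤ) + 1) * f l :=
      fun f => by
        rw [← Finset.sum_add_distrib]
        exact Finset.sum_congr rfl fun _ _ => by ring
    simp only [toParts, List.map_cons, List.sum_cons, ih, gapSum, List.length_cons,
      Finset.sum_range_succ', List.cons_append, List.getD_cons_succ, List.getD_cons_zero,
      Nat.cast_add, Nat.cast_one, Nat.cast_zero, hsplit, gapSum_eq_sum]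
    cases J with
    | nil => simp
    | cons k K => simp; ring

theorem toParts_mem_CeqSet_iff (n i m : ℕ) (hi : i ≤ n) (J : List ℕ) :
    toParts i J ∈ CeqSet n i m ↔ J ∈ SeqSet n i m := by
  have hcol : (∀ p ∈ toParts i J, p.2 ≤ n) ↔ ∀ j ∈ J, j ≤ n := by
    rw [← List.forall_mem_map (f := Prod.snd) (P := (· ≤ n)), map_snd_toParts]
    simp [or_imp, forall_and, hi]
  have hpen : (∀ p ∈ (toParts i J).reverse[1]?, p.2 ≠ i) ↔ ∀ j ∈ J.getLast?, j ≠ i := by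
    rw [← getElem?_one_reverse_toParts i J]
    simp only [Option.mem_def, Option.map_eq_some_iff, forall_exists_index, and_imp,
      forall_apply_eq_imp_iff₂]
  simp only [CeqSet, SeqSet, Set.mem_ofPred_eq, hcol, hpen, sum_map_fst_toParts,
    getLast?_toParts, true_and]
  exact ⟨fun h => ⟨h.1, h.2.2⟩, fun h => ⟨h.1, isChain_toParts i J, h.2⟩⟩

theorem CeqSet_eq_image_s4 (n i m : ℕ) (hi : i ≤ n) :
    CeqSet n i m = toParts i '' SeqSet n i m := by
  ext L
  constructor
  · intro hL
    obtain ⟨J, rfl⟩ := exists_toParts_eq i L hL.2.1 hL.2.2.1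
    exact ⟨J, (toParts_mem_CeqSet_iff n i m hi J).1 hL, rfl⟩
  · rintro ⟨J, hJ, rfl⟩
    exact (toParts_mem_CeqSet_iff n i m hi J).2 hJ

/-- Proposition 3.1 (counting form): `C_{i,n}(m)` equals the number of sequences
`(j_0,…,j_{s−1})` with `j_l ∈ {0,…,n}`, `j_{s−1} ≠ i` when `s ≥ 1`, and, setting `j_s := i`,
`∑_{l=0}^{s−1} (l+1)|j_l − j_{l+1}| = m`. -/
theorem ceqSeqCount (n i m : ℕ) (hi : i ≤ n) :
    Ceq n i m = (SeqSet n i m).ncard := by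
  rw [Ceq, CeqSet_eq_image_s4 n i m hi, Set.ncard_image_of_injective _ (toParts_injective i)]
end
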